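/- Let d ≥ 1 and α ∈ (−∞,−1]^e × (−1,∞)^{d−e} for some 1 ≤ e ≤ d. Define the maximal operator 𝕂_*^α f(x) = sup_{0<s<1} ∫_{(0,∞)^d} 𝕂_s^α(x,y) f(y) dν_α(y) for measurable f ≥ 0. Then there is a constant C (depending only on d and α) such that ν_α{x ∈ (0,∞)^d : 𝕂_*^α f(x) > λ} ≤ (C/λ) ∫_{(0,∞)^d} f(x) dν_α(x) for every λ > 0 and every 0 ≤ f ∈ L¹(dν_α). -/

import Mathlib

open MeasureTheory

/-- The measure `ν_α` on `(0,∞)^d` with density `(∏ x_i^{2α_i+1}) e^{−|x|²}`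
with respect to Lebesgue measure. -/
noncomputable def nu (d : ℕ) (α : Fin d → ℝ) : Measure (Fin d → ℝ) :=
  ((volume : Measure (Fin d → ℝ)).withDensity fun x =>
    ENNReal.ofReal ((∏ i, x i ^ (2 * α i + 1)) * Real.exp (-∑ i, x i ^ 2))).restrict
    {x | ∀ i, 0 < x i}

/-- The kernel
`K_s^α(x,y) = s^{−d/2} (∏ (x_i + √s)^{−2α_i−1}) exp(|x|² − |(1+s)x − (1−s)y|²/(8s))`. -/
noncomputable def Kker (d : ℕ) (α : Fin d → ℝ) (s : ℝ) (x y : Fin d → ℝ) : ℝ :=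
  s ^ (-(d : ℝ) / 2) * (∏ i, (x i + Real.sqrt s) ^ (-(2 * α i + 1))) *
    Real.exp ((∑ i, x i ^ 2) - (∑ i, ((1 + s) * x i - (1 - s) * y i) ^ 2) / (8 * s))

/-- The kernel `𝕂_s^α(x,y) = (1−s)^{−2⟨α′⟩} (∏_{i<e} (x_i y_i)^{−2α_i})
K_s^{−α′}(x′,y′) K_s^{α″}(x″,y″)`, where `z′ = (z_1,…,z_e)`, `z″ = (z_{e+1},…,z_d)`. -/
noncomputable def KK (d e : ℕ) (hed : e ≤ d) (α : Fin d → ℝ) (s : ℝ)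
    (x y : Fin d → ℝ) : ℝ :=
  (1 - s) ^ (-2 * ∑ i : Fin e, α (Fin.castLE hed i)) *
    (∏ i : Fin e, (x (Fin.castLE hed i) * y (Fin.castLE hed i)) ^
      (-2 * α (Fin.castLE hed i))) *
    Kker e (fun i => -α (Fin.castLE hed i)) s
      (fun i => x (Fin.castLE hed i)) (fun i => y (Fin.castLE hed i)) *
    Kker (d - e) (fun i => α ⟨e + (i : ℕ), by have h := i.isLt; omega⟩) s
      (fun i => x ⟨e + (i : ℕ), by have h := i.isLt; omega⟩)
      (fun i => y ⟨e + (i : ℕ), by have h := i.isLt; omega⟩)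


theorem lint_prod_fin (n : ℕ) (μ : Fin n → Measure ℝ) [∀ i, SigmaFinite (μ i)]
    (f : Fin n → ℝ → ENNReal) (hf : ∀ i, Measurable (f i)) :
    ∫⁻ x, ∏ i, f i (x i) ∂(Measure.pi μ) = ∏ i, ∫⁻ t, f i t ∂(μ i) := by
  induction n with
  | zero => simp
  | succ n ih =>
    have h := (measurePreserving_piFinSuccAbove μ 0).symm
    rw [← h.lintegral_comp_emb (MeasurableEquiv.measurableEmbedding _)]
    simp_rw [Fin.prod_univ_succ]
    have : ∀ a : ℝ × (Fin n → ℝ), f 0 (((MeasurableEquiv.piFinSuccAbove (fun _ => ℝ) 0).symm a) 0) *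
        ∏ i : Fin n, f i.succ (((MeasurableEquiv.piFinSuccAbove (fun _ => ℝ) 0).symm a) i.succ)
        = f 0 a.1 * ∏ i : Fin n, f i.succ (a.2 i) := by
      intro a; simp [MeasurableEquiv.piFinSuccAbove]
    simp_rw [this]
    rw [lintegral_prod_mul (f := f 0) (g := fun a : Fin n → ℝ => ∏ i : Fin n, f i.succ (a i))
      (hf 0).aemeasurable]
    · congr 1
      exact ih _ _ (fun i => hf _)
    · apply Measurable.aemeasurable
      exact Finset.measurable_prod _ (fun i _ => (hf _).comp (measurable_pi_apply i))

theorem lint_prod {ι : Type} [Fintype ι] (μ : ι → Measure ℝ) [∀ i, SigmaFinite (μ i)]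
    (f : ι → ℝ → ENNReal) (hf : ∀ i, Measurable (f i)) :
    ∫⁻ x, ∏ i, f i (x i) ∂(Measure.pi μ) = ∏ i, ∫⁻ t, f i t ∂(μ i) := by
  classical
  let e := (Fintype.equivFin ι).symm
  have h := measurePreserving_piCongrLeft μ e
  rw [← h.lintegral_comp_emb (MeasurableEquiv.measurableEmbedding _)]
  simp_rw [← e.prod_comp, MeasurableEquiv.coe_piCongrLeft, Equiv.piCongrLeft_apply_apply]
  exact lint_prod_fin _ (fun i => μ (e i)) (fun i => f (e i)) (fun i => hf _)

noncomputable def w1 (a x : ℝ) : ℝ := x ^ a * Real.exp (-x ^ 2)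

theorem w1_meas (a : ℝ) : Measurable (w1 a) := by unfold w1; fun_prop

theorem w1_pos (a : ℝ) {x : ℝ} (hx : 0 < x) : 0 < w1 a x := by unfold w1; positivity

noncomputable def nu1 (a : ℝ) : Measure ℝ :=
  (volume.restrict (Set.Ioi 0)).withDensity (fun x => ENNReal.ofReal (w1 a x))

instance (a : ℝ) : SigmaFinite (nu1 a) := by
  unfold nu1; infer_instance

theorem nu1_apply (a : ℝ) (s : Set ℝ) (hs : MeasurableSet s) :
    nu1 a s = ∫⁻ x, (s ∩ Set.Ioi 0).indicator (fun x => ENNReal.ofReal (w1 a x)) x := by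
  rw [nu1, withDensity_apply _ hs, Measure.restrict_restrict hs, lintegral_indicator]
  exact hs.inter measurableSet_Ioi

theorem nu_eq (d : ℕ) (α : Fin d → ℝ) :
    ((volume : Measure (Fin d → ℝ)).withDensity fun x =>
    ENNReal.ofReal ((∏ i, x i ^ (2 * α i + 1)) * Real.exp (-∑ i, x i ^ 2))).restrict
    {x | ∀ i, 0 < x i} = Measure.pi (fun i => nu1 (2 * α i + 1)) := by
  symm
  have hm : MeasurableSet {x : Fin d → ℝ | ∀ i, 0 < x i} := by
    rw [Set.ofPred_forall]
    exact MeasurableSet.iInter fun i => measurableSet_lt measurable_const (measurable_pi_apply i)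
  apply Measure.pi_eq
  intro s hs
  have hsm : MeasurableSet (Set.pi Set.univ s) := MeasurableSet.univ_pi hs
  rw [Measure.restrict_apply hsm, withDensity_apply _ (hsm.inter hm), ← lintegral_indicator (hsm.inter hm)]
  simp_rw [nu1_apply _ _ (hs _)]
  rw [← lint_prod (fun _ => volume)]
  · apply lintegral_congr
    intro x
    by_cases hx : x ∈ Set.pi Set.univ s ∩ {x | ∀ i, 0 < x i}
    · rw [Set.indicator_of_mem hx]
      have : ∀ i, x i ∈ s i ∩ Set.Ioi 0 := fun i => ⟨hx.1 i trivial, hx.2 i⟩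
      rw [Finset.prod_congr rfl (fun i _ => Set.indicator_of_mem (this i) _)]
      rw [← ENNReal.ofReal_prod_of_nonneg]
      · congr 1
        unfold w1
        rw [Finset.prod_mul_distrib, ← Real.exp_sum, Finset.sum_neg_distrib]
      · intro i _; exact (w1_pos _ (this i).2).le
    · rw [Set.indicator_of_notMem hx]
      have : ∃ i, x i ∉ s i ∩ Set.Ioi 0 := by
        by_contra hcon
        push Not at hcon
        exact hx ⟨fun i _ => (hcon i).1, fun i => (hcon i).2⟩
      obtain ⟨i, hi⟩ := this
      symm
      exact Finset.prod_eq_zero (Finset.mem_univ i) (Set.indicator_of_notMem hi _)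
  · intro i
    exact ((w1_meas _).ennreal_ofReal).indicator ((hs i).inter measurableSet_Ioi)


structure Geo (ν : Measure ℝ) (κ : ℝ → ℝ) (D : ENNReal) : Prop where
  meas : Measurable κ
  pos : ∀ x, 0 < x → 0 < κ x
  le_one : ∀ x, κ x ≤ 1
  slow : ∀ x x', 0 < x → 0 < x' → |x - x'| ≤ κ x + κ x' → κ x' ≤ 3 * κ x
  dbl : ∀ x τ, 0 < x → 0 < τ → τ ≤ κ x →
    ν (Set.Icc (x - 7 * τ) (x + 7 * τ)) ≤ D * ν (Set.Icc (x - τ) (x + τ))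

theorem vit {ι : Type} [Fintype ι] (ν : ι → Measure ℝ) [∀ i, SigmaFinite (ν i)]
    (κ : ι → ℝ → ℝ) (D : ι → ENNReal) (h : ∀ i, Geo (ν i) (κ i) (D i))
    (μ : Measure (ι → ℝ)) (lam : ENNReal) :
    lam * Measure.pi ν {x | (∀ i, 0 < x i) ∧ ∃ t : ℝ, 0 < t ∧
      lam * ∏ i, ν i (Set.Icc (x i - min t (κ i (x i))) (x i + min t (κ i (x i)))) ≤
      μ (Set.pi Set.univ fun i =>
        Set.Icc (x i - min t (κ i (x i))) (x i + min t (κ i (x i))))}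
      ≤ (∏ i, D i) * μ Set.univ := by
  classical
  let R : (ι → ℝ) × ℝ → ℝ → Set (ι → ℝ) := fun p c => Set.pi Set.univ fun i =>
    Set.Icc (p.1 i - c * min p.2 (κ i (p.1 i))) (p.1 i + c * min p.2 (κ i (p.1 i)))
  let T : Set ((ι → ℝ) × ℝ) := {p | (∀ i, 0 < p.1 i) ∧ 0 < p.2 ∧ p.2 ≤ 1 ∧
    lam * Measure.pi ν (R p 1) ≤ μ (R p 1)}
  have Rm : ∀ p c, MeasurableSet (R p c) := fun p c =>
    MeasurableSet.univ_pi fun i => measurableSet_Icc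
  have mpos : ∀ p ∈ T, ∀ i, 0 < min p.2 (κ i (p.1 i)) := fun p hp i =>
    lt_min hp.2.1 ((h i).pos _ (hp.1 i))
  obtain ⟨u, uT, udisj, hu⟩ := Vitali.exists_disjoint_subfamily_covering_enlargement
    (fun p => R p 1) T (fun p => p.2) 2 (by norm_num) (fun p hp => hp.2.1.le) 1
    (fun p hp => hp.2.2.1) (fun p hp => ⟨p.1, fun i _ => by
      have := mpos p hp i
      constructor <;> linarith⟩)
  have ucount : u.Countable := by
    apply udisj.countable_of_nonempty_interior
    intro p hp
    refine ⟨p.1, ?_⟩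
    simp only [R]
    rw [interior_pi_set Set.finite_univ]
    intro i _
    simp only [interior_Icc]
    have := mpos p (uT hp) i
    constructor <;> linarith
  have cover : {x | (∀ i, 0 < x i) ∧ ∃ t : ℝ, 0 < t ∧
      lam * ∏ i, ν i (Set.Icc (x i - min t (κ i (x i))) (x i + min t (κ i (x i)))) ≤
      μ (Set.pi Set.univ fun i =>
        Set.Icc (x i - min t (κ i (x i))) (x i + min t (κ i (x i))))} ⊆ ⋃ p ∈ u, R p 7 := by
    rintro x ⟨hx, t, ht, hle⟩
    have hmin : ∀ i, min (min t 1) (κ i (x i)) = min t (κ i (x i)) := by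
      intro i
      rw [min_assoc, min_eq_right ((h i).le_one _)]
    have hT : (x, min t 1) ∈ T := by
      refine ⟨hx, lt_min ht one_pos, min_le_right _ _, ?_⟩
      simp only [R, one_mul, hmin, Measure.pi_pi]
      exact hle
    obtain ⟨b, hb, ⟨z, hz1, hz2⟩, hδ⟩ := hu _ hT
    refine Set.mem_biUnion hb ?_
    intro i _
    have h1 := hz1 i trivial
    have h2 := hz2 i trivial
    simp only [one_mul] at h1 h2
    have hbT := uT hb
    have hbp := mpos b hbT i
    have hxp := mpos _ hT i
    simp only at hxp hδ
    have hk1 : min (min t 1) (κ i (x i)) ≤ κ i (x i) := min_le_right _ _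
    have hk2 : min b.2 (κ i (b.1 i)) ≤ κ i (b.1 i) := min_le_right _ _
    have hsl := (h i).slow (b.1 i) (x i) (hbT.1 i) (hx i) (by
      rw [abs_le]; constructor <;> linarith [h1.1, h1.2, h2.1, h2.2])
    have hkey : min (min t 1) (κ i (x i)) ≤ 3 * min b.2 (κ i (b.1 i)) := by
      rcases le_total b.2 (κ i (b.1 i)) with hc | hc
      · rw [min_eq_left hc]
        have : min (min t 1) (κ i (x i)) ≤ min t 1 := min_le_left _ _
        linarith [hbT.2.1]
      · rw [min_eq_right hc]; linarith
    constructor <;> linarith [h1.1, h1.2, h2.1, h2.2]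
  have step : ∀ p ∈ u, lam * Measure.pi ν (R p 7) ≤ (∏ i, D i) * μ (R p 1) := by
    intro p hp
    have hpT := uT hp
    calc lam * Measure.pi ν (R p 7) ≤ lam * ((∏ i, D i) * Measure.pi ν (R p 1)) := by
          gcongr
          simp only [R, Measure.pi_pi]
          rw [← Finset.prod_mul_distrib]
          apply Finset.prod_le_prod' 
          intro i _
          rw [one_mul]
          exact (h i).dbl _ _ (hpT.1 i) (mpos p hpT i) (min_le_right _ _)
      _ = (∏ i, D i) * (lam * Measure.pi ν (R p 1)) := by ring
      _ ≤ _ := by gcongr; exact hpT.2.2.2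
  have := ucount.to_subtype
  calc _ ≤ lam * Measure.pi ν (⋃ p ∈ u, R p 7) := by gcongr
    _ ≤ lam * ∑' p : u, Measure.pi ν (R p 7) := by
        gcongr; exact measure_biUnion_le _ ucount _
    _ = ∑' p : u, lam * Measure.pi ν (R p 7) := ENNReal.tsum_mul_left.symm
    _ ≤ ∑' p : u, (∏ i, D i) * μ (R p 1) := ENNReal.tsum_le_tsum fun p => step p p.2
    _ = (∏ i, D i) * ∑' p : u, μ (R p 1) := ENNReal.tsum_mul_left
    _ = (∏ i, D i) * μ (⋃ p ∈ u, R p 1) := by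
        rw [measure_biUnion ucount udisj (fun p _ => Rm p 1)]
    _ ≤ _ := by gcongr; exact Set.subset_univ _


noncomputable def box1 (κ : ℝ → ℝ) (t x y : ℝ) : ENNReal :=
  if |x - y| ≤ min t (κ x) then 1 else 0

theorem box1_meas {κ : ℝ → ℝ} (hκ : Measurable κ) (t : ℝ) :
    Measurable (fun p : ℝ × ℝ => box1 κ t p.1 p.2) := by
  unfold box1
  refine Measurable.ite (measurableSet_le ?_ ?_) measurable_const measurable_const
  · exact (continuous_abs.measurable).comp (measurable_fst.sub measurable_snd)
  · exact measurable_const.min (hκ.comp measurable_fst)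

theorem box1_eq (κ : ℝ → ℝ) (t x y : ℝ) : box1 κ t x y =
    (Set.Icc (x - min t (κ x)) (x + min t (κ x))).indicator 1 y := by
  unfold box1
  by_cases h : |x - y| ≤ min t (κ x)
  · rw [if_pos h, Set.indicator_of_mem]; rfl
    rw [abs_le] at h; constructor <;> linarith [h.1, h.2]
  · rw [if_neg h, Set.indicator_of_notMem]
    rintro ⟨h1, h2⟩
    exact h (by rw [abs_le]; constructor <;> linarith)

noncomputable def vol1 (ν : Measure ℝ) (κ : ℝ → ℝ) (t x : ℝ) : ENNReal :=
  ν (Set.Icc (x - min t (κ x)) (x + min t (κ x)))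

theorem vol1_meas (ν : Measure ℝ) [SigmaFinite ν] {κ : ℝ → ℝ} (hκ : Measurable κ) (t : ℝ) :
    Measurable (vol1 ν κ t) := by
  have h := Measurable.lintegral_prod_right' (ν := ν) (box1_meas hκ t)
  convert h using 2 with x
  simp only [box1_eq, vol1]
  rw [lintegral_indicator_one measurableSet_Icc]

section
variable {d : ℕ} (ν : Fin d → Measure ℝ) [∀ i, SigmaFinite (ν i)] (κ : Fin d → ℝ → ℝ)
  (N : Fin d → ℝ → ℝ → ENNReal)

noncomputable def Qt (L : Finset (Fin d)) (t : ℝ) (x y : Fin d → ℝ) : ENNReal :=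
  (∏ i ∈ L, box1 (κ i) t (x i) (y i)) * ∏ i ∈ Lᶜ, N i (x i) (y i)

theorem Qt_meas (hκ : ∀ i, Measurable (κ i))
    (hN : ∀ i, Measurable (fun p : ℝ × ℝ => N i p.1 p.2)) (L : Finset (Fin d)) (t : ℝ) :
    Measurable (fun p : (Fin d → ℝ) × (Fin d → ℝ) => Qt κ N L t p.1 p.2) := by
  unfold Qt
  refine Measurable.mul (Finset.measurable_prod _ fun i _ => ?_)
    (Finset.measurable_prod _ fun i _ => ?_)
  · exact (box1_meas (hκ i) t).comp
      (show Measurable (fun p : (Fin d → ℝ) × (Fin d → ℝ) => (p.1 i, p.2 i)) by fun_prop)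
  · exact (hN i).comp
      (show Measurable (fun p : (Fin d → ℝ) × (Fin d → ℝ) => (p.1 i, p.2 i)) by fun_prop)

theorem weakL (D : Fin d → ENNReal) (h : ∀ i, Geo (ν i) (κ i) (D i))
    (hN : ∀ i, Measurable (fun p : ℝ × ℝ => N i p.1 p.2)) (CN : Fin d → ENNReal)
    (hNi : ∀ i y, 0 < y → ∫⁻ x, N i x y ∂(ν i) ≤ CN i) (L : Finset (Fin d))
    (μ : Measure (Fin d → ℝ)) [IsFiniteMeasure μ] (hμ : ∀ᵐ y ∂μ, ∀ i, 0 < y i) (lam : ENNReal) :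
    lam * Measure.pi ν {x | (∀ i, 0 < x i) ∧ ∃ n : ℤ,
      lam * ∏ i ∈ L, vol1 (ν i) (κ i) ((2 : ℝ) ^ n) (x i) ≤
        ∫⁻ y, Qt κ N L ((2 : ℝ) ^ n) x y ∂μ} ≤
      ((∏ i ∈ L, D i) * ∏ i ∈ Lᶜ, CN i) * μ Set.univ := by
  set E := {x : Fin d → ℝ | (∀ i, 0 < x i) ∧ ∃ n : ℤ,
      lam * ∏ i ∈ L, vol1 (ν i) (κ i) ((2 : ℝ) ^ n) (x i) ≤
        ∫⁻ y, Qt κ N L ((2 : ℝ) ^ n) x y ∂μ} with hE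
  have hEm : MeasurableSet E := by
    have : E = (⋂ i, {x : Fin d → ℝ | 0 < x i}) ∩ ⋃ n : ℤ, {x : Fin d → ℝ |
      lam * ∏ i ∈ L, vol1 (ν i) (κ i) ((2 : ℝ) ^ n) (x i) ≤
        ∫⁻ y, Qt κ N L ((2 : ℝ) ^ n) x y ∂μ} := by
      ext x; simp [hE]
    rw [this]
    refine (MeasurableSet.iInter fun i => measurableSet_lt measurable_const
      (measurable_pi_apply i)).inter (MeasurableSet.iUnion fun n => measurableSet_le ?_ ?_)
    · exact (Finset.measurable_prod _ fun i _ =>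
        (vol1_meas (ν i) (h i).meas _).comp (measurable_pi_apply i)).const_mul _
    · exact Measurable.lintegral_prod_right' (ν := μ) (Qt_meas κ N (fun i => (h i).meas) hN L _)
  obtain ⟨p, hpL⟩ : ∃ p : Fin d → Prop, ∀ i, i ∈ L ↔ p i := ⟨fun i => i ∈ L, fun i => Iff.rfl⟩
  have : DecidablePred p := Classical.decPred p
  have hΦ := (measurePreserving_piEquivPiSubtypeProd ν p).symm
  set Φ := (MeasurableEquiv.piEquivPiSubtypeProd (fun _ : Fin d => ℝ) p)
  rw [← hΦ.measure_preimage hEm.nullMeasurableSet,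
    Measure.prod_apply_symm (hΦ.measurable hEm)]
  have hval1 : ∀ (q : ({i // p i} → ℝ) × ({i // ¬ p i} → ℝ)) (i : {i // p i}),
      Φ.symm q i.1 = q.1 i := by
    intro q i
    simp [Φ, MeasurableEquiv.piEquivPiSubtypeProd, Equiv.piEquivPiSubtypeProd, i.2]
  have hval2 : ∀ (q : ({i // p i} → ℝ) × ({i // ¬ p i} → ℝ)) (i : {i // ¬ p i}),
      Φ.symm q i.1 = q.2 i := by
    intro q i
    simp [Φ, MeasurableEquiv.piEquivPiSubtypeProd, Equiv.piEquivPiSubtypeProd, i.2]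
  have prodL : ∀ f : Fin d → ENNReal, ∏ i ∈ L, f i = ∏ i : {i // p i}, f i.1 := fun f =>
    Finset.prod_subtype L hpL f
  have prodF : ∀ f : Fin d → ENNReal, ∏ i ∈ Lᶜ, f i = ∏ i : {i // ¬ p i}, f i.1 := fun f =>
    Finset.prod_subtype Lᶜ (fun i => by rw [Finset.mem_compl, hpL]) f
  have NFm : Measurable (fun q : ({i // ¬ p i} → ℝ) × (Fin d → ℝ) =>
      ∏ i : {i // ¬ p i}, N i.1 (q.1 i) (q.2 i.1)) :=
    Finset.measurable_prod _ fun i _ => (hN i.1).comp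
      (show Measurable (fun q : ({i // ¬ p i} → ℝ) × (Fin d → ℝ) => (q.1 i, q.2 i.1)) by fun_prop)
  have sec : ∀ xF : {i // ¬ p i} → ℝ,
      lam * Measure.pi (fun i : {i // p i} => ν i.1)
        ((fun xL => (xL, xF)) ⁻¹' (Φ.symm ⁻¹' E)) ≤
      (∏ i ∈ L, D i) * ∫⁻ y, ∏ i : {i // ¬ p i}, N i.1 (xF i) (y i.1) ∂μ := by
    intro xF
    have gm : Measurable (fun y : Fin d → ℝ => ∏ i : {i // ¬ p i}, N i.1 (xF i) (y i.1)) :=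
      NFm.comp (measurable_const.prodMk measurable_id)
    let res : (Fin d → ℝ) → ({i // p i} → ℝ) := fun y i => y i.1
    have resm : Measurable res := measurable_pi_lambda _ fun i => measurable_pi_apply _
    let μ' : Measure ({i // p i} → ℝ) :=
      (μ.withDensity (fun y => ∏ i : {i // ¬ p i}, N i.1 (xF i) (y i.1))).map res
    have hμ'u : μ' Set.univ = ∫⁻ y, ∏ i : {i // ¬ p i}, N i.1 (xF i) (y i.1) ∂μ := by
      rw [Measure.map_apply resm MeasurableSet.univ, Set.preimage_univ,
        withDensity_apply _ MeasurableSet.univ, Measure.restrict_univ]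
    rw [← hμ'u, prodL]
    refine le_trans ?_ (vit (fun i : {i // p i} => ν i.1) (fun i => κ i.1) (fun i => D i.1)
      (fun i => h i.1) μ' lam)
    gcongr
    rintro xL ⟨hpos, n, hn⟩
    refine ⟨fun i => ?_, (2 : ℝ) ^ n, by positivity, ?_⟩
    · have := hpos i.1
      rwa [hval1] at this
    · rw [prodL] at hn
      simp only [vol1, hval1] at hn
      refine hn.trans (le_of_eq ?_)
      have hRm : MeasurableSet (Set.pi Set.univ fun i : {i // p i} =>
        Set.Icc (xL i - min ((2:ℝ) ^ n) (κ i.1 (xL i))) (xL i + min ((2:ℝ) ^ n) (κ i.1 (xL i)))) :=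
        MeasurableSet.univ_pi fun i => measurableSet_Icc
      rw [Measure.map_apply resm hRm, withDensity_apply _ (resm hRm),
        ← lintegral_indicator (resm hRm)]
      apply lintegral_congr
      intro y
      unfold Qt
      rw [prodL, prodF]
      simp only [hval1, hval2, box1_eq]
      by_cases hy : y ∈ res ⁻¹' (Set.pi Set.univ fun i : {i // p i} =>
        Set.Icc (xL i - min ((2:ℝ) ^ n) (κ i.1 (xL i))) (xL i + min ((2:ℝ) ^ n) (κ i.1 (xL i))))
      · rw [Set.indicator_of_mem hy, Finset.prod_eq_one, one_mul]
        intro i _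
        rw [Set.indicator_of_mem (hy i trivial)]; rfl
      · rw [Set.indicator_of_notMem hy]
        have : ∃ i : {i // p i}, y i.1 ∉ Set.Icc (xL i - min ((2:ℝ) ^ n) (κ i.1 (xL i)))
            (xL i + min ((2:ℝ) ^ n) (κ i.1 (xL i))) := by
          by_contra hcon
          push Not at hcon
          exact hy fun i _ => hcon i
        obtain ⟨i, hi⟩ := this
        rw [Finset.prod_eq_zero (Finset.mem_univ i) (Set.indicator_of_notMem hi _), zero_mul]
  have secm := measurable_measure_prodMk_right (μ := Measure.pi (fun i : {i // p i} => ν i.1))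
    (hΦ.measurable hEm)
  rw [← lintegral_const_mul _ secm]
  calc _ ≤ ∫⁻ xF, (∏ i ∈ L, D i) * ∫⁻ y, ∏ i : {i // ¬ p i}, N i.1 (xF i) (y i.1) ∂μ
        ∂(Measure.pi (fun i : {i // ¬ p i} => ν i.1)) := lintegral_mono sec
    _ = (∏ i ∈ L, D i) * ∫⁻ xF, ∫⁻ y, ∏ i : {i // ¬ p i}, N i.1 (xF i) (y i.1) ∂μ
        ∂(Measure.pi (fun i : {i // ¬ p i} => ν i.1)) :=
        lintegral_const_mul _ (Measurable.lintegral_prod_right' (ν := μ) NFm)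
    _ = (∏ i ∈ L, D i) * ∫⁻ y, ∫⁻ xF, ∏ i : {i // ¬ p i}, N i.1 (xF i) (y i.1)
        ∂(Measure.pi (fun i : {i // ¬ p i} => ν i.1)) ∂μ := by
        rw [lintegral_lintegral_swap NFm.aemeasurable]
    _ ≤ (∏ i ∈ L, D i) * ∫⁻ y, ∏ i ∈ Lᶜ, CN i ∂μ := by
        refine mul_le_mul' le_rfl ?_
        apply lintegral_mono_ae
        filter_upwards [hμ] with y hy
        rw [prodF, lint_prod (fun i : {i // ¬ p i} => ν i.1)
          (fun i u => N i.1 u (y i.1))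
          (fun i => (hN i.1).comp (measurable_id.prodMk measurable_const))]
        exact Finset.prod_le_prod' fun i _ => hNi i.1 _ (hy i.1)
    _ = _ := by rw [lintegral_const, mul_assoc]
end


theorem pow_exp_bdd (M : ℕ) (c : ℝ) (hc : 0 < c) : ∃ C : ℝ, 1 ≤ C ∧ ∀ u : ℝ, 0 ≤ u →
    u ^ M * Real.exp (-c * u ^ 2) ≤ C := by
  refine ⟨max 1 ((M.factorial : ℝ) / c ^ M + 1), le_max_left _ _, fun u hu => ?_⟩
  refine le_trans ?_ (le_max_right _ _)
  rcases le_or_gt u 1 with h | h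
  · have h1 : u ^ M ≤ 1 := pow_le_one₀ hu h
    have h2 : Real.exp (-c * u ^ 2) ≤ 1 := by
      rw [Real.exp_le_one_iff]; nlinarith [sq_nonneg u]
    have : 0 ≤ (M.factorial : ℝ) / c ^ M := by positivity
    nlinarith [Real.exp_pos (-c * u ^ 2), pow_nonneg hu M]
  · have h3 := Real.pow_div_factorial_le_exp (c * u ^ 2) (by positivity) M
    have h4 : u ^ M ≤ (u ^ 2) ^ M := by
      gcongr; nlinarith
    rw [neg_mul, Real.exp_neg, ← div_eq_mul_inv, div_le_iff₀ (Real.exp_pos _)]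
    have h5 : u ^ M ≤ (M.factorial : ℝ) / c ^ M * Real.exp (c * u ^ 2) := by
      rw [div_le_iff₀ (by positivity), mul_pow] at h3
      rw [div_mul_eq_mul_div, le_div_iff₀ (by positivity)]
      nlinarith [pow_pos hc M]
    nlinarith [Real.exp_pos (c * u ^ 2)]

set_option maxHeartbeats 1600000 in
theorem regB {d : ℕ} (ν : Fin d → Measure ℝ) [∀ i, SigmaFinite (ν i)] (κ : Fin d → ℝ → ℝ)
    (N : Fin d → ℝ → ℝ → ENNReal) (D : Fin d → ENNReal) (h : ∀ i, Geo (ν i) (κ i) (D i))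
    (hD : ∀ i, D i ≠ ⊤)
    (hN : ∀ i, Measurable (fun p : ℝ × ℝ => N i p.1 p.2)) (CN : Fin d → ENNReal)
    (hCN : ∀ i, CN i ≠ ⊤)
    (hNi : ∀ i y, 0 < y → ∫⁻ x, N i x y ∂(ν i) ≤ CN i)
    (k : Fin d → ℝ → ℝ → ℝ → ENNReal) (Cl : ℝ) (hCl : 1 ≤ Cl) (m : ℕ)
    (hk : ∀ i s x y, 0 < s → s < 1 → 0 < x → 0 < y → s * x ^ 2 ≤ 1 →
      k i s x y ≤ N i x y ∨ (|x - y| ≤ κ i x ∧ ∀ t, √s ≤ t → |x - y| ≤ t →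
        k i s x y * vol1 (ν i) (κ i) t x ≤
          ENNReal.ofReal (Cl * (t / √s) ^ m * Real.exp (-(x - y) ^ 2 / (128 * s))))) :
    ∃ C : ENNReal, C ≠ ⊤ ∧ ∀ (μ : Measure (Fin d → ℝ)) [IsFiniteMeasure μ],
      (∀ᵐ y ∂μ, ∀ i, 0 < y i) → ∀ lam : ENNReal,
      lam * Measure.pi ν {x | (∀ i, 0 < x i) ∧ ∃ s : ℝ, 0 < s ∧ s < 1 ∧
        (∀ i, s * x i ^ 2 ≤ 1) ∧ lam < ∫⁻ y, ∏ i, k i s (x i) (y i) ∂μ} ≤ C * μ Set.univ := by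
  classical
  obtain ⟨C1, hC1, hC1'⟩ := pow_exp_bdd (m * d + 1) (1 / 512) (by norm_num)
  set C0 : ℝ := Cl ^ d * max (2 ^ (m * d)) C1 with hC0
  have hC0pos : 0 < C0 := by
    have : 0 < max (2 ^ (m * d)) C1 := lt_of_lt_of_le (by linarith) (le_max_right _ _)
    positivity
  -- pointwise estimate
  have pw : ∀ (s : ℝ) (m0 : ℤ) (x y : Fin d → ℝ), 0 < s → s < 1 → (2 : ℝ) ^ m0 < √s →
      √s ≤ 2 ^ (m0 + 1) → (∀ i, 0 < x i) → (∀ i, 0 < y i) → (∀ i, s * x i ^ 2 ≤ 1) →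
      ∏ i, k i s (x i) (y i) ≤ ∑ L : Finset (Fin d), ∑' j : ℕ,
        ENNReal.ofReal (C0 * (1 / 2) ^ j) / (∏ i ∈ L, vol1 (ν i) (κ i) ((2 : ℝ) ^ (m0 + 1 + j)) (x i)) *
          Qt κ N L ((2 : ℝ) ^ (m0 + 1 + j)) x y := by
    intro s m0 x y hs hs1 hm0 hm0' hx hy hsx
    have hr : 0 < √s := Real.sqrt_pos.2 hs
    let L : Finset (Fin d) := Finset.univ.filter fun i => ¬ k i s (x i) (y i) ≤ N i (x i) (y i)
    have hL : ∀ i ∈ L, (|x i - y i| ≤ κ i (x i) ∧ ∀ t, √s ≤ t → |x i - y i| ≤ t →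
        k i s (x i) (y i) * vol1 (ν i) (κ i) t (x i) ≤
          ENNReal.ofReal (Cl * (t / √s) ^ m * Real.exp (-(x i - y i) ^ 2 / (128 * s)))) := by
      intro i hi
      have hi' := (Finset.mem_filter.1 hi).2
      exact (hk i s (x i) (y i) hs hs1 (hx i) (hy i) (hsx i)).resolve_left hi'
    have hLc : ∀ i ∈ Lᶜ, k i s (x i) (y i) ≤ N i (x i) (y i) := by
      intro i hi
      by_contra hcon
      exact (Finset.mem_compl.1 hi) (Finset.mem_filter.2 ⟨Finset.mem_univ _, hcon⟩)
    have hex : ∃ j : ℕ, ∀ i ∈ L, |x i - y i| ≤ (2 : ℝ) ^ (m0 + 1 + (j : ℤ)) := by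
      refine ⟨(-(m0 + 1)).toNat, fun i hi => ?_⟩
      refine ((hL i hi).1.trans ((h i).le_one _)).trans ?_
      apply one_le_zpow₀ (by norm_num)
      have := Int.self_le_toNat (-(m0 + 1))
      linarith
    set j := Nat.find hex with hj
    have hjs : ∀ i ∈ L, |x i - y i| ≤ (2 : ℝ) ^ (m0 + 1 + (j : ℤ)) := Nat.find_spec hex
    set t : ℝ := (2 : ℝ) ^ (m0 + 1 + (j : ℤ)) with ht
    have ht2 : t = 2 ^ (m0 + 1) * 2 ^ j := by
      rw [ht, zpow_add₀ (by norm_num)]; norm_num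
    have hj1 : (1 : ℝ) ≤ 2 ^ j := one_le_pow₀ (by norm_num)
    have hst : √s ≤ t := by
      rw [ht2]; nlinarith
    have hu : (2 : ℝ) ^ j ≤ t / √s := by
      rw [le_div_iff₀ hr, ht2, mul_comm]
      gcongr
    have hcard : L.card ≤ d := by simpa using L.card_le_univ
    have main : (∏ i ∈ L, k i s (x i) (y i)) * ∏ i ∈ L, vol1 (ν i) (κ i) t (x i) ≤
        ENNReal.ofReal (C0 * (1 / 2) ^ j) := by
      rw [← Finset.prod_mul_distrib]
      refine (Finset.prod_le_prod' fun i hi => (hL i hi).2 t hst (hjs i hi)).trans ?_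
      rw [← ENNReal.ofReal_prod_of_nonneg (fun i _ => by positivity)]
      apply ENNReal.ofReal_le_ofReal
      rw [Finset.prod_mul_distrib, Finset.prod_const, mul_pow, ← pow_mul, hC0, mul_assoc, mul_assoc]
      have hcl : Cl ^ L.card ≤ Cl ^ d := pow_le_pow_right₀ hCl hcard
      have hu1 : 1 ≤ t / √s := hj1.trans hu
      have hup : (t / √s) ^ (m * L.card) ≤ (t / √s) ^ (m * d) :=
        pow_le_pow_right₀ hu1 (Nat.mul_le_mul_left _ hcard)
      refine mul_le_mul hcl ?_ (by positivity) (by positivity)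
      rcases Nat.eq_zero_or_pos j with h0 | h0
      · rw [h0, pow_zero, mul_one]
        refine le_trans ?_ (le_max_left _ _)
        have e1 : ∏ i ∈ L, Real.exp (-(x i - y i) ^ 2 / (128 * s)) ≤ 1 := by
          apply Finset.prod_le_one (fun i _ => (Real.exp_pos _).le)
          intro i _
          rw [Real.exp_le_one_iff]
          apply div_nonpos_of_nonpos_of_nonneg
          · nlinarith [sq_nonneg (x i - y i)]
          · positivity
        have e2 : t / √s ≤ 2 := by
          rw [div_le_iff₀ hr, ht2, h0, pow_zero, mul_one, zpow_add₀ (by norm_num), zpow_one]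
          linarith
        calc _ ≤ (t / √s) ^ (m * L.card) * 1 := by gcongr
          _ ≤ (t / √s) ^ (m * d) := by rw [mul_one]; exact hup
          _ ≤ _ := by gcongr
      · have hnot : ¬ ∀ i ∈ L, |x i - y i| ≤ (2 : ℝ) ^ (m0 + 1 + ((j - 1 : ℕ) : ℤ)) :=
          Nat.find_min hex (by omega)
        push Not at hnot
        obtain ⟨i0, hi0, hlt⟩ := hnot
        have hhalf : (2 : ℝ) ^ (m0 + 1 + ((j - 1 : ℕ) : ℤ)) = t / 2 := by
          rw [ht, Nat.cast_sub h0, Nat.cast_one, show m0 + 1 + ((j : ℤ) - 1) = m0 + 1 + j - 1 by ring,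
            zpow_sub_one₀ (by norm_num)]; rfl
        rw [hhalf] at hlt
        have e1 : ∏ i ∈ L, Real.exp (-(x i - y i) ^ 2 / (128 * s)) ≤
            Real.exp (-(1 / 512) * (t / √s) ^ 2) := by
          rw [← Real.exp_sum]
          apply Real.exp_le_exp.2
          calc ∑ i ∈ L, -(x i - y i) ^ 2 / (128 * s) ≤ -(x i0 - y i0) ^ 2 / (128 * s) := by
                have := Finset.sum_le_sum_of_subset_of_nonneg (s := {i0}) (t := L)
                  (f := fun i => (x i - y i) ^ 2 / (128 * s)) (by simpa using hi0)
                  (fun i _ _ => by positivity)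
                rw [Finset.sum_singleton] at this
                simp only [neg_div, Finset.sum_neg_distrib]
                linarith
            _ ≤ _ := by
                rw [div_pow, Real.sq_sqrt hs.le]
                have : (t / 2) ^ 2 ≤ (x i0 - y i0) ^ 2 := by
                  rw [← sq_abs (x i0 - y i0)]
                  have : 0 < t := hr.trans_le hst
                  gcongr
                rw [div_le_iff₀ (by positivity)]
                field_simp
                nlinarith
        have e2 := hC1' (t / √s) (by positivity)
        have hupos : 0 < t / √s := by linarith
        calc _ ≤ (t / √s) ^ (m * d) * Real.exp (-(1 / 512) * (t / √s) ^ 2) := by gcongr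
          _ ≤ C1 / (t / √s) := by
              rw [le_div_iff₀ hupos]
              rw [pow_succ] at e2
              linarith
          _ ≤ C1 / 2 ^ j := by gcongr
          _ ≤ _ := by
              rw [one_div, inv_pow, ← div_eq_mul_inv]
              gcongr
              exact le_max_right _ _
    have hQ : Qt κ N L t x y = ∏ i ∈ Lᶜ, N i (x i) (y i) := by
      unfold Qt
      rw [Finset.prod_eq_one, one_mul]
      intro i hi
      unfold box1
      rw [if_pos (le_min (hjs i hi) (hL i hi).1)]
    have hpos : ENNReal.ofReal (C0 * (1 / 2) ^ j) ≠ 0 := by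
      rw [Ne, ENNReal.ofReal_eq_zero, not_le]; positivity
    calc ∏ i, k i s (x i) (y i) = (∏ i ∈ L, k i s (x i) (y i)) * ∏ i ∈ Lᶜ, k i s (x i) (y i) :=
          (Finset.prod_mul_prod_compl _ _).symm
      _ ≤ ENNReal.ofReal (C0 * (1 / 2) ^ j) / (∏ i ∈ L, vol1 (ν i) (κ i) t (x i)) *
          Qt κ N L t x y := by
          rw [hQ]
          refine mul_le_mul' ?_ (Finset.prod_le_prod' hLc)
          rw [ENNReal.le_div_iff_mul_le (Or.inr hpos) (Or.inr ENNReal.ofReal_ne_top)]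
          exact main
      _ ≤ ∑' j : ℕ, ENNReal.ofReal (C0 * (1 / 2) ^ j) /
            (∏ i ∈ L, vol1 (ν i) (κ i) ((2 : ℝ) ^ (m0 + 1 + j)) (x i)) *
          Qt κ N L ((2 : ℝ) ^ (m0 + 1 + j)) x y := ENNReal.le_tsum j
      _ ≤ _ := Finset.single_le_sum (f := fun L : Finset (Fin d) => ∑' j : ℕ,
          ENNReal.ofReal (C0 * (1 / 2) ^ j) /
            (∏ i ∈ L, vol1 (ν i) (κ i) ((2 : ℝ) ^ (m0 + 1 + j)) (x i)) *
          Qt κ N L ((2 : ℝ) ^ (m0 + 1 + j)) x y) (fun _ _ => zero_le) (Finset.mem_univ L)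
  set K : ENNReal := (Fintype.card (Finset (Fin d)) : ENNReal) * ENNReal.ofReal (2 * C0) with hK
  have hK0 : K ≠ 0 := by
    rw [hK]; apply mul_ne_zero
    · simp
    · rw [Ne, ENNReal.ofReal_eq_zero, not_le]; positivity
  have hKt : K ≠ ⊤ := ENNReal.mul_ne_top (ENNReal.natCast_ne_top _) ENNReal.ofReal_ne_top
  refine ⟨K * ∑ L : Finset (Fin d), ((∏ i ∈ L, D i) * ∏ i ∈ Lᶜ, CN i), ?_, ?_⟩
  · refine ENNReal.mul_ne_top hKt (ENNReal.sum_ne_top.2 fun L _ => ENNReal.mul_ne_top ?_ ?_)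
    · exact ENNReal.prod_ne_top fun i _ => hD i
    · exact ENNReal.prod_ne_top fun i _ => hCN i
  intro μ _ hμ lam
  set lam' := lam / K with hlam'
  have hll : lam = K * lam' := by rw [hlam', ENNReal.mul_div_cancel hK0 hKt]
  let E : Finset (Fin d) → Set (Fin d → ℝ) := fun L => {x | (∀ i, 0 < x i) ∧ ∃ n : ℤ,
      lam' * ∏ i ∈ L, vol1 (ν i) (κ i) ((2 : ℝ) ^ n) (x i) ≤
        ∫⁻ y, Qt κ N L ((2 : ℝ) ^ n) x y ∂μ}
  have hsub : {x | (∀ i, 0 < x i) ∧ ∃ s : ℝ, 0 < s ∧ s < 1 ∧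
        (∀ i, s * x i ^ 2 ≤ 1) ∧ lam < ∫⁻ y, ∏ i, k i s (x i) (y i) ∂μ} ⊆
      ⋃ L ∈ (Finset.univ : Finset (Finset (Fin d))), E L := by
    rintro x ⟨hx, s, hs, hs1, hsx, hlt⟩
    by_contra hcon
    simp only [Finset.mem_univ, Set.iUnion_true, Set.mem_iUnion, not_exists] at hcon
    have hcon2 : ∀ L : Finset (Fin d), ∀ n : ℤ, (∫⁻ y, Qt κ N L ((2 : ℝ) ^ n) x y ∂μ) ≤
        lam' * ∏ i ∈ L, vol1 (ν i) (κ i) ((2 : ℝ) ^ n) (x i) := by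
      intro L n
      by_contra hc
      exact hcon L ⟨hx, n, (not_le.1 hc).le⟩
    obtain ⟨m0, hm0⟩ := exists_mem_Ioc_zpow (Real.sqrt_pos.2 hs) (one_lt_two)
    have hQm : ∀ L t, Measurable (fun y => Qt κ N L t x y) := fun L t =>
      (Qt_meas κ N (fun i => (h i).meas) hN L t).comp (measurable_const.prodMk measurable_id)
    refine absurd hlt (not_lt.2 ?_)
    calc ∫⁻ y, ∏ i, k i s (x i) (y i) ∂μ ≤ ∫⁻ y, ∑ L : Finset (Fin d), ∑' j : ℕ,
        ENNReal.ofReal (C0 * (1 / 2) ^ j) / (∏ i ∈ L, vol1 (ν i) (κ i) ((2 : ℝ) ^ (m0 + 1 + j)) (x i)) *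
          Qt κ N L ((2 : ℝ) ^ (m0 + 1 + j)) x y ∂μ := by
          apply lintegral_mono_ae
          filter_upwards [hμ] with y hy
          exact pw s m0 x y hs hs1 hm0.1 hm0.2 hx hy hsx
      _ = ∑ L : Finset (Fin d), ∑' j : ℕ,
        ENNReal.ofReal (C0 * (1 / 2) ^ j) / (∏ i ∈ L, vol1 (ν i) (κ i) ((2 : ℝ) ^ (m0 + 1 + j)) (x i)) *
          ∫⁻ y, Qt κ N L ((2 : ℝ) ^ (m0 + 1 + j)) x y ∂μ := by
          rw [lintegral_finsetSum _ (fun L _ => Measurable.tsum fun j => (hQm L _).const_mul _)]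
          refine Finset.sum_congr rfl fun L _ => ?_
          rw [lintegral_tsum (fun j => ((hQm L _).const_mul _).aemeasurable)]
          exact tsum_congr fun j => lintegral_const_mul _ (hQm L _)
      _ ≤ ∑ L : Finset (Fin d), ∑' j : ℕ, ENNReal.ofReal (C0 * (1 / 2) ^ j) * lam' := by
          refine Finset.sum_le_sum fun L _ => ENNReal.tsum_le_tsum fun j => ?_
          rw [div_eq_mul_inv, mul_assoc]
          refine mul_le_mul' le_rfl ?_
          rw [mul_comm, ← div_eq_mul_inv]
          exact ENNReal.div_le_of_le_mul (hcon2 L _)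
      _ = K * lam' := by
          have : ∑' j : ℕ, ENNReal.ofReal (C0 * (1 / 2) ^ j) = ENNReal.ofReal (2 * C0) := by
            rw [← ENNReal.ofReal_tsum_of_nonneg (fun j => by positivity)
              (summable_geometric_two.mul_left C0), tsum_mul_left, tsum_geometric_two, mul_comm]
          simp_rw [ENNReal.tsum_mul_right, this]
          rw [Finset.sum_const, Finset.card_univ, nsmul_eq_mul, hK, mul_assoc]
      _ = lam := hll.symm
  calc lam * Measure.pi ν _ ≤ lam * Measure.pi ν (⋃ L ∈ (Finset.univ : Finset (Finset (Fin d))), E L) := by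
        gcongr
    _ ≤ lam * ∑ L : Finset (Fin d), Measure.pi ν (E L) := by
        gcongr; exact measure_biUnion_finset_le _ _
    _ = K * ∑ L : Finset (Fin d), lam' * Measure.pi ν (E L) := by
        rw [← Finset.mul_sum, ← mul_assoc, ← hll]
    _ ≤ K * ∑ L : Finset (Fin d), (((∏ i ∈ L, D i) * ∏ i ∈ Lᶜ, CN i) * μ Set.univ) := by
        refine mul_le_mul' le_rfl (Finset.sum_le_sum fun L _ => ?_)
        exact weakL ν κ N D h hN CN hNi L μ hμ lam'
    _ = _ := by rw [← Finset.sum_mul, ← mul_assoc]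


theorem lint_scale (f : ℝ → ENNReal) (hf : Measurable f) {c : ℝ} (hc : 0 < c) :
    ∫⁻ x, ENNReal.ofReal c * f (c * x) = ∫⁻ x, f x := by
  have h := Real.smul_map_volume_mul_left (a := c) hc.ne'
  conv_rhs => rw [← h, lintegral_smul_measure, lintegral_map hf (by fun_prop)]
  have hm : Measurable (fun x => f (c * x)) := hf.comp (by fun_prop)
  rw [lintegral_const_mul _ hm, abs_of_pos hc]
  rfl

noncomputable def NN (b x y : ℝ) : ℝ :=
  (if x ≤ 2 then x ^ (-b) else 0) + x * Real.exp (-(1 / 1024) * x ^ 2) +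
    y * Real.exp (-(1 / 1024) * (y * (x - y)) ^ 2) + y⁻¹ * (1 + (y⁻¹ * x) ^ 2)⁻¹

theorem NN_meas (b : ℝ) : Measurable (fun p : ℝ × ℝ => NN b p.1 p.2) := by
  unfold NN
  refine Measurable.add (Measurable.add (Measurable.add (Measurable.ite ?_ ?_ ?_) ?_) ?_) ?_
  · exact measurableSet_le measurable_fst measurable_const
  all_goals fun_prop

theorem NN_nonneg (b : ℝ) {x y : ℝ} (hx : 0 < x) (hy : 0 < y) : 0 ≤ NN b x y := by
  unfold NN
  have : 0 ≤ (if x ≤ 2 then x ^ (-b) else 0) := by split_ifs <;> positivity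
  positivity

theorem NN_int (b : ℝ) (hb : b < 1) : ∃ C : ENNReal, C ≠ ⊤ ∧ ∀ y, 0 < y →
    ∫⁻ x in Set.Ioi 0, ENNReal.ofReal (NN b x y) ≤ C := by
  have i1 : ∫⁻ x in Set.Ioi (0:ℝ), ENNReal.ofReal (if x ≤ 2 then x ^ (-b) else 0) ≠ ⊤ := by
    have : IntegrableOn (fun x : ℝ => x ^ (-b)) (Set.Ioc 0 2) := by
      have := intervalIntegral.intervalIntegrable_rpow' (a := 0) (b := 2) (r := -b) (by linarith)
      rwa [intervalIntegrable_iff_integrableOn_Ioc_of_le (by norm_num)] at this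
    have h2 := this.lintegral_lt_top.ne
    convert h2 using 1
    rw [← lintegral_indicator measurableSet_Ioi, ← lintegral_indicator measurableSet_Ioc]
    apply lintegral_congr
    intro x
    by_cases h0 : 0 < x <;> by_cases h1 : x ≤ 2 <;> simp [Set.indicator, h0, h1]
  have i2 : ∫⁻ x in Set.Ioi (0:ℝ), ENNReal.ofReal (x * Real.exp (-(1 / 1024) * x ^ 2)) ≠ ⊤ := by
    have := (integrable_mul_exp_neg_mul_sq (b := (1/1024 : ℝ)) (by norm_num)).integrableOn
      (s := Set.Ioi 0)
    exact this.lintegral_lt_top.ne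
  have i3 : ∫⁻ x : ℝ, ENNReal.ofReal (Real.exp (-(1 / 1024) * x ^ 2)) ≠ ⊤ :=
    (integrable_exp_neg_mul_sq (b := (1/1024 : ℝ)) (by norm_num)).lintegral_lt_top.ne
  have i4 : ∫⁻ x : ℝ, ENNReal.ofReal (1 + x ^ 2)⁻¹ ≠ ⊤ :=
    integrable_inv_one_add_sq.lintegral_lt_top.ne
  refine ⟨_, ENNReal.add_ne_top.2 ⟨ENNReal.add_ne_top.2 ⟨ENNReal.add_ne_top.2 ⟨i1, i2⟩, i3⟩, i4⟩, ?_⟩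
  intro y hy
  have s3 : ∫⁻ x : ℝ, ENNReal.ofReal (y * Real.exp (-(1 / 1024) * (y * (x - y)) ^ 2)) =
      ∫⁻ x : ℝ, ENNReal.ofReal (Real.exp (-(1 / 1024) * x ^ 2)) := by
    rw [← lint_scale (fun x => ENNReal.ofReal (Real.exp (-(1 / 1024) * x ^ 2))) (by fun_prop) hy]
    rw [← lintegral_sub_right_eq_self (fun x => ENNReal.ofReal y *
      ENNReal.ofReal (Real.exp (-(1 / 1024) * (y * x) ^ 2))) y]
    simp_rw [ENNReal.ofReal_mul hy.le]
  have s4 : ∫⁻ x : ℝ, ENNReal.ofReal (y⁻¹ * (1 + (y⁻¹ * x) ^ 2)⁻¹) =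
      ∫⁻ x : ℝ, ENNReal.ofReal (1 + x ^ 2)⁻¹ := by
    rw [← lint_scale (fun x => ENNReal.ofReal (1 + x ^ 2)⁻¹) (by fun_prop) (inv_pos.2 hy)]
    simp_rw [ENNReal.ofReal_mul (inv_pos.2 hy).le]
  rw [← s3, ← s4]
  have m1 : Measurable (fun x : ℝ => ENNReal.ofReal (if x ≤ 2 then x ^ (-b) else 0)) := by
    apply Measurable.ennreal_ofReal
    exact Measurable.ite measurableSet_Iic (by fun_prop) measurable_const
  have m2 : Measurable (fun x : ℝ => ENNReal.ofReal (x * Real.exp (-(1 / 1024) * x ^ 2))) := by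
    fun_prop
  have m3 : Measurable (fun x : ℝ => ENNReal.ofReal
    (y * Real.exp (-(1 / 1024) * (y * (x - y)) ^ 2))) := by fun_prop
  calc _ ≤ ∫⁻ x in Set.Ioi 0, (ENNReal.ofReal (if x ≤ 2 then x ^ (-b) else 0) +
        ENNReal.ofReal (x * Real.exp (-(1 / 1024) * x ^ 2)) +
        ENNReal.ofReal (y * Real.exp (-(1 / 1024) * (y * (x - y)) ^ 2)) +
        ENNReal.ofReal (y⁻¹ * (1 + (y⁻¹ * x) ^ 2)⁻¹)) := by
        apply lintegral_mono
        intro x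
        unfold NN
        refine ENNReal.ofReal_add_le.trans (add_le_add (ENNReal.ofReal_add_le.trans
          (add_le_add ENNReal.ofReal_add_le le_rfl)) le_rfl)
    _ = _ := by
        rw [lintegral_add_left (by exact (m1.add m2).add m3),
          lintegral_add_left (by exact m1.add m2), lintegral_add_left m1]
    _ ≤ _ := by
        refine add_le_add (add_le_add le_rfl ?_) ?_ <;> exact setLIntegral_le_lintegral _ _

/-- ratio lemma -/
theorem rpow_ratio {r R : ℝ} (a : ℝ) (hR : 1 ≤ R) (h1 : 1 / R ≤ r) (h2 : r ≤ R) :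
    r ^ a ≤ R ^ |a| := by
  have hr : 0 < r := lt_of_lt_of_le (by positivity) h1
  rcases le_total 0 a with h | h
  · rw [abs_of_nonneg h]; exact Real.rpow_le_rpow hr.le h2 h
  · rw [abs_of_nonpos h]
    have : R ^ (-a) = (1 / R) ^ a := by
      rw [one_div, Real.inv_rpow (by linarith), Real.rpow_neg (by linarith)]
    rw [this]
    exact Real.rpow_le_rpow_of_nonpos (by positivity) h1 h

theorem rpow_ratio' {u v R : ℝ} (a : ℝ) (hR : 1 ≤ R) (hv : 0 < v) (h1 : v ≤ R * u)
    (h2 : u ≤ R * v) : u ^ a ≤ R ^ |a| * v ^ a := by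
  have hu : 0 < u := by nlinarith
  have := rpow_ratio (r := u / v) a hR (by
    rw [div_le_div_iff₀ (by linarith) hv]; linarith) (by rwa [div_le_iff₀ hv])
  rwa [Real.div_rpow hu.le hv.le, div_le_iff₀ (by positivity)] at this


theorem nu1_le (a c : ℝ) (S : Set ℝ) (hS : MeasurableSet S)
    (h : ∀ y ∈ S, 0 < y → w1 a y ≤ c) : nu1 a S ≤ ENNReal.ofReal c * volume S := by
  rw [nu1_apply _ _ hS, ← lintegral_indicator_const hS]
  apply lintegral_mono
  intro y
  by_cases hy : y ∈ S
  · by_cases hy0 : 0 < y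
    · rw [Set.indicator_of_mem (show y ∈ S ∩ Set.Ioi 0 from ⟨hy, hy0⟩), Set.indicator_of_mem hy]
      exact ENNReal.ofReal_le_ofReal (h y hy hy0)
    · rw [Set.indicator_of_notMem (fun hh => hy0 hh.2)]; exact zero_le
  · rw [Set.indicator_of_notMem (fun hh => hy hh.1)]; exact zero_le

theorem nu1_ge (a c : ℝ) (S : Set ℝ) (hS : MeasurableSet S)
    (h : ∀ y ∈ S, 0 < y ∧ c ≤ w1 a y) : ENNReal.ofReal c * volume S ≤ nu1 a S := by
  rw [nu1_apply _ _ hS, ← lintegral_indicator_const hS]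
  apply lintegral_mono
  intro y
  by_cases hy : y ∈ S
  · rw [Set.indicator_of_mem (show y ∈ S ∩ Set.Ioi 0 from ⟨hy, (h y hy).1⟩), Set.indicator_of_mem hy]
    exact ENNReal.ofReal_le_ofReal (h y hy).2
  · rw [Set.indicator_of_notMem hy]; exact zero_le

theorem exp_cmp {x y τ : ℝ} (hx : 0 < x) (hτ : 0 < τ) (h1 : τ ≤ 1) (h2 : τ * x ≤ 1)
    (hy : |y - x| ≤ 7 * τ) : Real.exp (-y ^ 2) ≤ Real.exp 63 * Real.exp (-x ^ 2) ∧
      Real.exp (-63) * Real.exp (-x ^ 2) ≤ Real.exp (-y ^ 2) := by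
  rw [abs_le] at hy
  have h3 : x ^ 2 - y ^ 2 ≤ 63 := by nlinarith
  have h4 : y ^ 2 - x ^ 2 ≤ 63 := by nlinarith
  constructor <;> rw [← Real.exp_add, Real.exp_le_exp] <;> linarith

theorem meas_lo (a : ℝ) {x τ : ℝ} (hx : 0 < x) (hτ : 0 < τ) (h1 : τ ≤ 1) (h2 : τ * x ≤ 1) :
    ENNReal.ofReal ((2 ^ |a|)⁻¹ * Real.exp (-63) / 2 * ((x + τ) ^ a * τ * Real.exp (-x ^ 2))) ≤
      nu1 a (Set.Icc (x - τ) (x + τ)) := by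
  have key := nu1_ge a ((2 ^ |a|)⁻¹ * (x + τ) ^ a * (Real.exp (-63) * Real.exp (-x ^ 2)))
    (Set.Icc (x + τ / 2) (x + τ)) measurableSet_Icc (by
      rintro y ⟨hy1, hy2⟩
      have hy0 : 0 < y := by linarith
      refine ⟨hy0, ?_⟩
      unfold w1
      have e := (exp_cmp hx hτ h1 h2 (y := y) (by rw [abs_le]; constructor <;> linarith)).2
      have r := rpow_ratio' (u := x + τ) (v := y) (R := 2) a (by norm_num) hy0 (by linarith)
        (by linarith)
      have r2 : (2 ^ |a|)⁻¹ * (x + τ) ^ a ≤ y ^ a := by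
        rwa [inv_mul_le_iff₀ (by positivity)]
      gcongr)
  refine le_trans (le_of_eq ?_) (key.trans (measure_mono (Set.Icc_subset_Icc (by linarith) le_rfl)))
  rw [Real.volume_Icc, ← ENNReal.ofReal_mul (by positivity)]
  congr 1
  ring

theorem meas_up (a : ℝ) : ∃ C : ℝ, 0 < C ∧ ∀ x τ : ℝ, 0 < x → 0 < τ → τ ≤ 1 → τ * x ≤ 1 →
    (14 * τ ≤ x ∨ -1 < a) →
    nu1 a (Set.Icc (x - 7 * τ) (x + 7 * τ)) ≤
      ENNReal.ofReal (C * ((x + τ) ^ a * τ * Real.exp (-x ^ 2))) := by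
  refine ⟨14 * 4 ^ |a| * Real.exp 63 + |21 ^ (a + 1) / (a + 1)| * 15 ^ |a| * Real.exp 63,
    by positivity, ?_⟩
  intro x τ hx hτ h1 h2 h3
  have mono1 : ∀ {A B : ℝ}, 0 ≤ A → 0 ≤ B → ∀ W : ℝ, 0 ≤ W → A * W ≤ (A + B) * W ∧ B * W ≤ (A + B) * W := by
    intro A B hA hB W hW
    constructor <;> nlinarith [mul_nonneg hA hW, mul_nonneg hB hW]
  have mono := mono1 (A := 14 * 4 ^ |a| * Real.exp 63)
    (B := |21 ^ (a + 1) / (a + 1)| * 15 ^ |a| * Real.exp 63) (by positivity) (by positivity)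
    ((x + τ) ^ a * τ * Real.exp (-x ^ 2)) (by positivity)
  by_cases h14 : 14 * τ ≤ x
  · have key := nu1_le a (4 ^ |a| * (x + τ) ^ a * (Real.exp 63 * Real.exp (-x ^ 2)))
      (Set.Icc (x - 7 * τ) (x + 7 * τ)) measurableSet_Icc (by
        rintro y ⟨hy1, hy2⟩ hy0
        unfold w1
        have e := (exp_cmp hx hτ h1 h2 (y := y) (by rw [abs_le]; constructor <;> linarith)).1
        have r := rpow_ratio' (u := y) (v := x + τ) (R := 4) a (by norm_num) (by linarith)
          (by linarith) (by linarith)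
        gcongr)
    refine key.trans ?_
    rw [Real.volume_Icc, ← ENNReal.ofReal_mul (by positivity)]
    apply ENNReal.ofReal_le_ofReal
    refine le_trans (le_of_eq ?_) mono.1
    ring
  · have ha : -1 < a := h3.resolve_left h14
    push Not at h14
    rw [nu1_apply _ _ measurableSet_Icc]
    have ii := intervalIntegral.intervalIntegrable_rpow' (a := 0) (b := 21 * τ) ha
    rw [intervalIntegrable_iff_integrableOn_Ioc_of_le (by positivity)] at ii
    have ii2 := ii.const_mul (Real.exp 63 * Real.exp (-x ^ 2))
    have hint : ∫ y in Set.Ioc 0 (21 * τ), Real.exp 63 * Real.exp (-x ^ 2) * y ^ a =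
        Real.exp 63 * Real.exp (-x ^ 2) * ((21 * τ) ^ (a + 1) / (a + 1)) := by
      rw [integral_const_mul, ← intervalIntegral.integral_of_le (by positivity),
        integral_rpow (Or.inl ha), Real.zero_rpow (by linarith), sub_zero]
    calc _ ≤ ∫⁻ y in Set.Ioc 0 (21 * τ), ENNReal.ofReal (Real.exp 63 * Real.exp (-x ^ 2) * y ^ a) := by
          rw [← lintegral_indicator measurableSet_Ioc]
          apply lintegral_mono
          intro y
          by_cases hy : y ∈ Set.Icc (x - 7 * τ) (x + 7 * τ) ∩ Set.Ioi 0
          · have hy0 : 0 < y := hy.2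
            rw [Set.indicator_of_mem hy, Set.indicator_of_mem
              (show y ∈ Set.Ioc 0 (21 * τ) from ⟨hy0, by linarith [hy.1.2]⟩)]
            apply ENNReal.ofReal_le_ofReal
            unfold w1
            have e := (exp_cmp hx hτ h1 h2 (y := y)
              (by rw [abs_le]; constructor <;> linarith [hy.1.1, hy.1.2])).1
            rw [mul_comm]
            gcongr
          · rw [Set.indicator_of_notMem hy]; exact zero_le
      _ = ENNReal.ofReal (∫ y in Set.Ioc 0 (21 * τ), Real.exp 63 * Real.exp (-x ^ 2) * y ^ a) := by
          rw [ofReal_integral_eq_lintegral_ofReal ii2]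
          filter_upwards [ae_restrict_mem measurableSet_Ioc] with y hy
          have := hy.1
          positivity
      _ ≤ _ := by
          rw [hint]
          apply ENNReal.ofReal_le_ofReal
          refine le_trans ?_ mono.2
          have r := rpow_ratio' (u := τ) (v := x + τ) (R := 15) a (by norm_num) (by linarith)
            (by linarith) (by linarith)
          rw [Real.mul_rpow (by norm_num) hτ.le, Real.rpow_add hτ, Real.rpow_one]
          have e2 : |(21 : ℝ) ^ (a + 1) / (a + 1)| = 21 ^ (a + 1) / (a + 1) := by
            apply abs_of_nonneg
            have : 0 < a + 1 := by linarith
            positivity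
          rw [e2]
          have : 0 < a + 1 := by linarith
          calc _ = 21 ^ (a + 1) / (a + 1) * τ ^ a * (Real.exp 63 * (τ * Real.exp (-x ^ 2))) := by ring
            _ ≤ 21 ^ (a + 1) / (a + 1) * (15 ^ |a| * (x + τ) ^ a) *
              (Real.exp 63 * (τ * Real.exp (-x ^ 2))) := by gcongr
            _ = _ := by ring

noncomputable def kapg (x : ℝ) : ℝ := 1 / max 1 x
noncomputable def kapb (x : ℝ) : ℝ := min (kapg x) (x / 20)

theorem kapg_le (x : ℝ) : kapg x ≤ 1 := by
  unfold kapg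
  rw [div_le_one (by positivity)]; exact le_max_left _ _
theorem kapg_pos (x : ℝ) : 0 < kapg x := by unfold kapg; positivity
theorem kapg_mul (x : ℝ) : kapg x * x ≤ 1 := by
  unfold kapg
  rw [div_mul_eq_mul_div, div_le_one (by positivity), one_mul]; exact le_max_right _ _

theorem kapg_slow (x x' : ℝ) (h : |x - x'| ≤ 2) : kapg x' ≤ 3 * kapg x := by
  unfold kapg
  rw [mul_one_div, div_le_div_iff₀ (by positivity) (by positivity), one_mul]
  rw [abs_le] at h
  apply max_le
  · linarith [le_max_left 1 x']
  · linarith [le_max_left 1 x', le_max_right 1 x']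

theorem geo_dbl (a : ℝ) : ∃ D : ENNReal, D ≠ ⊤ ∧ ∀ x τ : ℝ, 0 < x → 0 < τ → τ ≤ 1 → τ * x ≤ 1 →
    (14 * τ ≤ x ∨ -1 < a) →
    nu1 a (Set.Icc (x - 7 * τ) (x + 7 * τ)) ≤ D * nu1 a (Set.Icc (x - τ) (x + τ)) := by
  obtain ⟨C, hC, h⟩ := meas_up a
  set c := (2 ^ |a|)⁻¹ * Real.exp (-63) / 2 with hc
  have hcp : 0 < c := by positivity
  refine ⟨ENNReal.ofReal (C / c), ENNReal.ofReal_ne_top, fun x τ hx hτ h1 h2 h3 => ?_⟩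
  refine (h x τ hx hτ h1 h2 h3).trans ?_
  refine le_trans (le_of_eq ?_) (mul_le_mul' le_rfl (meas_lo a hx hτ h1 h2))
  rw [← hc, ← ENNReal.ofReal_mul (by positivity)]
  congr 1
  field_simp

theorem geo_good (a : ℝ) (ha : -1 < a) : ∃ D : ENNReal, D ≠ ⊤ ∧ Geo (nu1 a) kapg D := by
  obtain ⟨D, hD, h⟩ := geo_dbl a
  refine ⟨D, hD, ⟨by unfold kapg; fun_prop, fun x _ => kapg_pos x, kapg_le, ?_, ?_⟩⟩
  · intro x x' _ _ hh
    exact kapg_slow x x' (hh.trans (by linarith [kapg_le x, kapg_le x']))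
  · intro x τ hx hτ hle
    refine h x τ hx hτ (hle.trans (kapg_le x)) ?_ (Or.inr ha)
    have := kapg_mul x
    nlinarith

theorem geo_bad (a : ℝ) : ∃ D : ENNReal, D ≠ ⊤ ∧ Geo (nu1 a) kapb D := by
  obtain ⟨D, hD, h⟩ := geo_dbl a
  have hle1 : ∀ x, kapb x ≤ kapg x := fun x => min_le_left _ _
  have hle2 : ∀ x, kapb x ≤ x / 20 := fun x => min_le_right _ _
  refine ⟨D, hD, ⟨by unfold kapb kapg; fun_prop, fun x hx => lt_min (kapg_pos x) (by linarith),
    fun x => (hle1 x).trans (kapg_le x), ?_, ?_⟩⟩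
  · intro x x' hx hx' hh
    have h1 := kapg_slow x x' (hh.trans (by linarith [kapg_le x, kapg_le x', hle1 x, hle1 x']))
    have h2 := hle2 x
    have h3 := hle2 x'
    rw [abs_le] at hh
    have : 3 * kapb x = min (3 * kapg x) (3 * (x / 20)) := by
      unfold kapb; rw [mul_min_of_nonneg _ _ (by norm_num)]
    rw [this]
    apply le_min
    · exact (hle1 _).trans h1
    · linarith
  · intro x τ hx hτ hle
    refine h x τ hx hτ (hle.trans ((hle1 x).trans (kapg_le x))) ?_ (Or.inl ?_)
    · have := kapg_mul x
      have := hle1 x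
      nlinarith
    · have := hle2 x; linarith


theorem rpow_exp_bdd (p c : ℝ) (hp : 0 ≤ p) (hc : 0 < c) : ∃ C : ℝ, 1 ≤ C ∧ ∀ u : ℝ, 0 ≤ u →
    u ^ p * Real.exp (-c * u ^ 2) ≤ C := by
  obtain ⟨C, hC, h⟩ := pow_exp_bdd ⌈p⌉₊ c hc
  refine ⟨1 + C, by linarith, fun u hu => ?_⟩
  have h1 : u ^ p ≤ 1 + u ^ ⌈p⌉₊ := by
    rcases le_total u 1 with h | h
    · have := Real.rpow_le_one hu h hp
      have : 0 ≤ u ^ ⌈p⌉₊ := by positivity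
      linarith
    · have : u ^ p ≤ u ^ ((⌈p⌉₊ : ℕ) : ℝ) := Real.rpow_le_rpow_of_exponent_le h (Nat.le_ceil p)
      rw [Real.rpow_natCast] at this
      linarith
  have h2 : Real.exp (-c * u ^ 2) ≤ 1 := by
    rw [Real.exp_le_one_iff]; nlinarith [sq_nonneg u]
  have := h u hu
  nlinarith [Real.exp_pos (-c * u ^ 2)]

noncomputable def qq (s x y : ℝ) : ℝ := ((1 + s) * x - (1 - s) * y) ^ 2 / (8 * s)

theorem qq_nonneg {s : ℝ} (hs : 0 < s) (x y : ℝ) : 0 ≤ qq s x y := by unfold qq; positivity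

noncomputable def kg (a s x y : ℝ) : ℝ :=
  (√s)⁻¹ * (x + √s) ^ (-a) * Real.exp (x ^ 2 - qq s x y)

noncomputable def kb (β s x y : ℝ) : ℝ :=
  (1 - s) ^ (2 * β) * (x * y) ^ (2 * β) * kg (2 * β + 1) s x y

noncomputable def UU (b s x y : ℝ) : ℝ :=
  (√s)⁻¹ * (1 + √s / x) ^ b * Real.exp (-(qq s x y / 2))

theorem ub_good (a : ℝ) {s x y : ℝ} (hs : 0 < s) (hx : 0 < x) :
    kg a s x y * w1 a x ≤ UU (max 0 (-a)) s x y := by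
  have hr : 0 < √s := Real.sqrt_pos.2 hs
  have hq := qq_nonneg hs x y
  unfold kg w1 UU
  have e1 : (x + √s) ^ (-a) * x ^ a = (1 + √s / x) ^ (-a) := by
    rw [show 1 + √s / x = (x + √s) / x by field_simp, Real.div_rpow (by positivity) hx.le,
      Real.rpow_neg hx.le, div_inv_eq_mul]
  have e2 : Real.exp (x ^ 2 - qq s x y) * Real.exp (-x ^ 2) = Real.exp (-qq s x y) := by
    rw [← Real.exp_add]; congr 1; ring
  have e3 : (1 + √s / x) ^ (-a) ≤ (1 + √s / x) ^ (max 0 (-a)) := by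
    apply Real.rpow_le_rpow_of_exponent_le _ (le_max_right _ _)
    have : 0 < √s / x := by positivity
    linarith
  have e4 : Real.exp (-qq s x y) ≤ Real.exp (-(qq s x y / 2)) := by
    rw [Real.exp_le_exp]; linarith
  calc _ = (√s)⁻¹ * ((x + √s) ^ (-a) * x ^ a) * (Real.exp (x ^ 2 - qq s x y) * Real.exp (-x ^ 2)) := by ring
    _ ≤ _ := by
      rw [e1, e2]; gcongr

theorem bad_eq (β : ℝ) {s x y : ℝ} (hs : 0 < s) (hs1 : s < 1) (hx : 0 < x) (hy : 0 < y) :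
    kb β s x y * w1 (1 - 2 * β) x = (√s)⁻¹ * ((1 - s) * y / (x + √s)) ^ (2 * β) *
      (x / (x + √s)) * Real.exp (-qq s x y) := by
  have hr : 0 < √s := Real.sqrt_pos.2 hs
  have h1s : 0 < 1 - s := by linarith
  unfold kb kg w1
  have e2 : Real.exp (x ^ 2 - qq s x y) * Real.exp (-x ^ 2) = Real.exp (-qq s x y) := by
    rw [← Real.exp_add]; congr 1; ring
  rw [← e2, Real.div_rpow (by positivity) (by positivity), Real.mul_rpow h1s.le hy.le,
    Real.mul_rpow hx.le hy.le, Real.rpow_neg (by positivity), Real.rpow_add (by positivity),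
    Real.rpow_sub hx, Real.rpow_one, Real.rpow_one]
  have : 0 < x ^ (2 * β) := by positivity
  have : 0 < (x + √s) ^ (2 * β) := by positivity
  field_simp

theorem ub_bad (β : ℝ) (hβ : 1 ≤ β) : ∃ C : ℝ, 1 ≤ C ∧ ∀ s x y : ℝ, 0 < s → s < 1 → 0 < x → 0 < y →
    kb β s x y * w1 (1 - 2 * β) x ≤ C * UU 0 s x y := by
  obtain ⟨C, hC, h⟩ := rpow_exp_bdd (2 * β) (1 / 4) (by linarith) (by norm_num)
  have h3 : (1 : ℝ) ≤ 3 ^ (2 * β) := Real.one_le_rpow (by norm_num) (by linarith)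
  refine ⟨3 ^ (2 * β) * (2 * C), by nlinarith, fun s x y hs hs1 hx hy => ?_⟩
  have hr : 0 < √s := Real.sqrt_pos.2 hs
  have h1s : 0 < 1 - s := by linarith
  have hq := qq_nonneg hs x y
  rw [bad_eq β hs hs1 hx hy]
  unfold UU
  rw [Real.rpow_zero, mul_one]
  set q := qq s x y with hqd
  have hv := Real.sqrt_nonneg q
  have hqs : q = √q ^ 2 := (Real.sq_sqrt hq).symm
  have k1 : (1 - s) * y ≤ 3 * (x + √s) * (1 + √q) := by
    have e : ((1 - s) * y - (1 + s) * x) ^ 2 ≤ (3 * √s * √q) ^ 2 := by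
      rw [mul_pow, mul_pow, Real.sq_sqrt hs.le, Real.sq_sqrt hq, hqd]
      unfold qq
      have : 3 ^ 2 * s * (((1 + s) * x - (1 - s) * y) ^ 2 / (8 * s)) =
        9 / 8 * ((1 + s) * x - (1 - s) * y) ^ 2 := by field_simp; ring
      rw [this]
      nlinarith [sq_nonneg ((1 + s) * x - (1 - s) * y)]
    have e2 := abs_le_of_sq_le_sq e (by positivity)
    have := (abs_le.1 e2).2
    nlinarith [mul_nonneg hx.le hv, mul_nonneg hr.le hv]
  have k2 : (1 - s) * y / (x + √s) ≤ 3 * (1 + √q) := by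
    rw [div_le_iff₀ (by positivity)]; linarith
  have k3 : ((1 - s) * y / (x + √s)) ^ (2 * β) ≤ 3 ^ (2 * β) * (1 + √q) ^ (2 * β) := by
    rw [← Real.mul_rpow (by norm_num) (by positivity)]
    apply Real.rpow_le_rpow (by positivity) k2 (by linarith)
  have k4 : x / (x + √s) ≤ 1 := by rw [div_le_one (by positivity)]; linarith
  have k5 : (1 + √q) ^ (2 * β) * Real.exp (-q) ≤ 2 * C * Real.exp (-(q / 2)) := by
    have e1 := h (1 + √q) (by positivity)
    have e2 : Real.exp (-q) ≤ 2 * Real.exp (-(1 / 4) * (1 + √q) ^ 2) * Real.exp (-(q / 2)) := by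
      have : Real.exp (1 / 2) ≤ 2 := by
        have := Real.exp_bound_div_one_sub_of_interval (x := 1/2) (by norm_num) (by norm_num)
        norm_num at this ⊢; exact this
      calc Real.exp (-q) ≤ Real.exp (1 / 2) * Real.exp (-(1 / 4) * (1 + √q) ^ 2) * Real.exp (-(q / 2)) := by
            rw [← Real.exp_add, ← Real.exp_add, Real.exp_le_exp]
            nlinarith [sq_nonneg (√q - 1)]
        _ ≤ _ := by gcongr
    calc _ ≤ (1 + √q) ^ (2 * β) * (2 * Real.exp (-(1 / 4) * (1 + √q) ^ 2) * Real.exp (-(q / 2))) := by gcongr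
      _ = 2 * ((1 + √q) ^ (2 * β) * Real.exp (-(1 / 4) * (1 + √q) ^ 2)) * Real.exp (-(q / 2)) := by ring
      _ ≤ _ := by gcongr
  calc _ ≤ (√s)⁻¹ * (3 ^ (2 * β) * (1 + √q) ^ (2 * β)) * 1 * Real.exp (-q) := by gcongr
    _ = (√s)⁻¹ * 3 ^ (2 * β) * ((1 + √q) ^ (2 * β) * Real.exp (-q)) := by ring
    _ ≤ (√s)⁻¹ * 3 ^ (2 * β) * (2 * C * Real.exp (-(q / 2))) := by gcongr
    _ = _ := by ring

theorem qlow {s x y : ℝ} (hs : 0 < s) (hs2 : s ≤ 1 / 2) (hsx : s * x ^ 2 ≤ 1) :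
    Real.exp (-(qq s x y / 2)) ≤ 2 * Real.exp (-(x - y) ^ 2 / (128 * s)) := by
  have h1 : (x - y) ^ 2 / (64 * s) - 1 / 2 ≤ qq s x y := by
    unfold qq
    rw [div_sub' (by positivity), div_le_div_iff₀ (by positivity) (by positivity)]
    have : (x - y) ^ 2 - 32 * s ≤ 8 * ((1 + s) * x - (1 - s) * y) ^ 2 := by
      have e : (1 + s) * x - (1 - s) * y = (1 - s) * (x - y) + 2 * s * x := by ring
      rw [e]
      have a1 : (1 / 4) * (x - y) ^ 2 ≤ ((1 - s) * (x - y)) ^ 2 := by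
        rw [mul_pow]; gcongr; nlinarith
      have a2 : (2 * s * x) ^ 2 ≤ 4 * s := by nlinarith
      nlinarith [sq_nonneg ((1 - s) * (x - y) + 2 * (2 * s * x))]
    nlinarith
  have h2 : Real.exp (1 / 4) ≤ 2 := by
    have := Real.exp_bound_div_one_sub_of_interval (x := 1/4) (by norm_num) (by norm_num)
    norm_num at this ⊢; linarith
  calc _ ≤ Real.exp (1 / 4) * Real.exp (-(x - y) ^ 2 / (128 * s)) := by
        rw [← Real.exp_add, Real.exp_le_exp]
        have : -(x - y) ^ 2 / (128 * s) = -((x - y) ^ 2 / (64 * s)) / 2 := by field_simp; ring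
        rw [this]
        linarith
    _ ≤ _ := by gcongr


theorem NN_ge (b : ℝ) {x y : ℝ} (hx : 0 < x) (hy : 0 < y) :
    (x ≤ 2 → x ^ (-b) ≤ NN b x y) ∧
    (x * Real.exp (-(1 / 1024) * x ^ 2) + y * Real.exp (-(1 / 1024) * (y * (x - y)) ^ 2) ≤ NN b x y) ∧
    y⁻¹ * (1 + (y⁻¹ * x) ^ 2)⁻¹ ≤ NN b x y := by
  have h1 : 0 ≤ (if x ≤ 2 then x ^ (-b) else 0) := by split_ifs <;> positivity
  have h2 : 0 ≤ x * Real.exp (-(1 / 1024) * x ^ 2) := by positivity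
  have h3 : 0 ≤ y * Real.exp (-(1 / 1024) * (y * (x - y)) ^ 2) := by positivity
  have h4 : 0 ≤ y⁻¹ * (1 + (y⁻¹ * x) ^ 2)⁻¹ := by positivity
  unfold NN
  refine ⟨fun h => ?_, ?_, ?_⟩
  · rw [if_pos h]; linarith
  · linarith
  · linarith

/-- the case x ≥ 1 -/
theorem NN_ge2 (b : ℝ) {x y : ℝ} (hx : 1 ≤ x) (hy : 0 < y) :
    x * Real.exp (-(x * (x - y)) ^ 2 / 256) ≤ 2 * NN b x y := by
  have h := (NN_ge b (by linarith : 0 < x) hy).2.1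
  have hy' : 0 ≤ y * Real.exp (-(1 / 1024) * (y * (x - y)) ^ 2) := by positivity
  have hx' : 0 ≤ x * Real.exp (-(1 / 1024) * x ^ 2) := by positivity
  by_cases hc : x ≤ 2 * y ∧ y ≤ 2 * x
  · have : x * Real.exp (-(x * (x - y)) ^ 2 / 256) ≤
        (2 * y) * Real.exp (-(1 / 1024) * (y * (x - y)) ^ 2) := by
      gcongr
      · exact hc.1
      · have : (y * (x - y)) ^ 2 ≤ 4 * (x * (x - y)) ^ 2 := by
          rw [mul_pow, mul_pow, ← mul_assoc]; gcongr; nlinarith [hc.2]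
        linarith
    linarith
  · have : x * Real.exp (-(x * (x - y)) ^ 2 / 256) ≤ x * Real.exp (-(1 / 1024) * x ^ 2) := by
      gcongr
      have hd : x ^ 2 / 4 ≤ (x - y) ^ 2 := by
        rcases not_and_or.1 hc with h | h
        · push Not at h; nlinarith
        · push Not at h; nlinarith
      have : x ^ 2 / 4 ≤ (x * (x - y)) ^ 2 := by
        rw [mul_pow]
        have hx2 : 1 ≤ x ^ 2 := by nlinarith
        nlinarith [sq_nonneg (x - y)]
      linarith
    linarith

theorem nonloc (b : ℝ) (hb : 0 ≤ b) : ∃ C : ℝ, 1 ≤ C ∧ ∀ s x y : ℝ, 0 < s → s < 1 →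
    0 < x → 0 < y → s * x ^ 2 ≤ 1 → (1 / 2 ≤ s ∨ kapg x < |x - y|) →
    UU b s x y ≤ C * NN b x y := by
  obtain ⟨C, hC, h⟩ := rpow_exp_bdd 1 (1 / 256) (by norm_num) (by norm_num)
  have h3 : (1 : ℝ) ≤ 3 ^ b := Real.one_le_rpow (by norm_num) hb
  refine ⟨8 * (3 ^ b * C), by nlinarith, fun s x y hs hs1 hx hy hsx hcase => ?_⟩
  have hr : 0 < √s := Real.sqrt_pos.2 hs
  have hr1 : √s ≤ 1 := by rw [Real.sqrt_le_one]; exact hs1.le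
  have hN := NN_nonneg b hx hy
  have hC0 : 0 < C := by linarith
  have hq := qq_nonneg hs x y
  have hrx : 0 < √s / x := by positivity
  have base : x ≤ 2 → (1 + √s / x) ^ b ≤ 3 ^ b * x ^ (-b) := by
    intro hx2
    rw [Real.rpow_neg hx.le, ← div_eq_mul_inv, ← Real.div_rpow (by norm_num) hx.le]
    apply Real.rpow_le_rpow (by positivity) _ hb
    rw [show 1 + √s / x = (x + √s) / x by field_simp]
    gcongr; linarith
  unfold UU
  by_cases hs2 : 1 / 2 ≤ s
  · have hx2 : x ≤ 2 := by nlinarith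
    have e1 : (√s)⁻¹ ≤ 2 := by
      rw [inv_le_comm₀ hr (by norm_num)]
      apply Real.le_sqrt_of_sq_le; norm_num; linarith
    have e2 : Real.exp (-(qq s x y / 2)) ≤ 1 := by rw [Real.exp_le_one_iff]; linarith
    have e3 := (NN_ge b hx hy).1 hx2
    calc _ ≤ 2 * (3 ^ b * x ^ (-b)) * 1 := by gcongr; exact base hx2
      _ ≤ 2 * (3 ^ b * NN b x y) * 1 := by gcongr
      _ ≤ _ := by nlinarith [mul_nonneg (by linarith : (0:ℝ) ≤ 3 ^ b) hN]
  · push Not at hs2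
    have hD : kapg x < |x - y| := hcase.resolve_left (not_le.2 hs2)
    have hq2 := qlow (y := y) hs hs2.le hsx
    have hDpos : 0 < |x - y| := (kapg_pos x).trans hD
    have gen : (√s)⁻¹ * Real.exp (-(x - y) ^ 2 / (128 * s)) ≤
        C / |x - y| * Real.exp (-(x - y) ^ 2 / (256 * s)) := by
      have e1 := h (|x - y| / √s) (by positivity)
      rw [Real.rpow_one, div_pow, sq_abs, Real.sq_sqrt hs.le] at e1
      have e2 : Real.exp (-(x - y) ^ 2 / (128 * s)) = Real.exp (-(1 / 256) * ((x - y) ^ 2 / s)) *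
          Real.exp (-(x - y) ^ 2 / (256 * s)) := by
        rw [← Real.exp_add]; congr 1; field_simp; ring
      rw [e2, ← mul_assoc]
      gcongr
      rw [le_div_iff₀ hDpos]
      calc _ = |x - y| / √s * Real.exp (-(1 / 256) * ((x - y) ^ 2 / s)) := by ring
        _ ≤ _ := e1
    rcases le_total x 1 with hx1 | hx1
    · have hk : kapg x = 1 := by unfold kapg; rw [max_eq_left hx1]; norm_num
      rw [hk] at hD
      have e3 := (NN_ge b hx hy).1 (by linarith)
      have e4 : C / |x - y| ≤ C := div_le_self hC0.le hD.le
      have e5 : Real.exp (-(x - y) ^ 2 / (256 * s)) ≤ 1 := by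
        rw [Real.exp_le_one_iff, neg_div]
        have : 0 ≤ (x - y) ^ 2 / (256 * s) := by positivity
        linarith
      calc _ ≤ (√s)⁻¹ * (3 ^ b * x ^ (-b)) * (2 * Real.exp (-(x - y) ^ 2 / (128 * s))) := by
            gcongr; exact base (by linarith)
        _ = 2 * (3 ^ b * x ^ (-b)) * ((√s)⁻¹ * Real.exp (-(x - y) ^ 2 / (128 * s))) := by ring
        _ ≤ 2 * (3 ^ b * NN b x y) * (C * 1) := by
            have : (√s)⁻¹ * Real.exp (-(x - y) ^ 2 / (128 * s)) ≤ C * 1 :=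
              gen.trans (by gcongr)
            gcongr
        _ ≤ _ := by nlinarith [mul_nonneg (mul_nonneg (by linarith : (0:ℝ) ≤ 3 ^ b) hC0.le) hN]
    · have hk : kapg x = 1 / x := by unfold kapg; rw [max_eq_right hx1]
      rw [hk] at hD
      have e3 := NN_ge2 b hx1 hy
      have e4 : C / |x - y| ≤ C * x := by
        rw [div_le_iff₀ hDpos]
        rw [div_lt_iff₀ hx] at hD
        nlinarith
      have e5 : Real.exp (-(x - y) ^ 2 / (256 * s)) ≤ Real.exp (-(x * (x - y)) ^ 2 / 256) := by
        rw [Real.exp_le_exp, neg_div, neg_div, neg_le_neg_iff, div_le_div_iff₀ (by norm_num) (by positivity)]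
        have := mul_le_mul_of_nonneg_right hsx (sq_nonneg (x - y))
        nlinarith
      have e6 : (1 + √s / x) ^ b ≤ 3 ^ b := by
        apply Real.rpow_le_rpow (by positivity) _ hb
        have : √s / x ≤ 1 := by rw [div_le_one hx]; linarith
        linarith
      calc _ ≤ (√s)⁻¹ * 3 ^ b * (2 * Real.exp (-(x - y) ^ 2 / (128 * s))) := by
            gcongr
        _ = 2 * 3 ^ b * ((√s)⁻¹ * Real.exp (-(x - y) ^ 2 / (128 * s))) := by ring
        _ ≤ 2 * 3 ^ b * (C * x * Real.exp (-(x * (x - y)) ^ 2 / 256)) := by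
            refine mul_le_mul_of_nonneg_left ?_ (by positivity)
            exact gen.trans (by gcongr)
        _ = 2 * 3 ^ b * C * (x * Real.exp (-(x * (x - y)) ^ 2 / 256)) := by ring
        _ ≤ 2 * 3 ^ b * C * (2 * NN b x y) := by gcongr
        _ ≤ _ := by nlinarith [mul_nonneg (mul_nonneg (by linarith : (0:ℝ) ≤ 3 ^ b) hC0.le) hN]

theorem nonloc_bad (β b : ℝ) (hβ : 1 ≤ β) : ∃ C : ℝ, 1 ≤ C ∧ ∀ s x y : ℝ, 0 < s → s ≤ 1 / 2 →
    0 < x → 0 < y → s * x ^ 2 ≤ 1 → x / 20 < |x - y| →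
    kb β s x y * w1 (1 - 2 * β) x ≤ C * NN b x y := by
  obtain ⟨C, hC, h⟩ := rpow_exp_bdd (2 * β + 1) (1 / (128 * 441)) (by linarith) (by norm_num)
  refine ⟨4 * C, by linarith, fun s x y hs hs2 hx hy hsx hD => ?_⟩
  have hr : 0 < √s := Real.sqrt_pos.2 hs
  have hC0 : 0 < C := by linarith
  have hq := qq_nonneg hs x y
  have h1s : 0 < 1 - s := by linarith
  rw [bad_eq β hs (by linarith) hx hy]
  set M := max x y with hM
  have hxM : x ≤ M := le_max_left _ _
  have hyM : y ≤ M := le_max_right _ _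
  have hM0 : 0 < M := by linarith
  have hDM : M ≤ 21 * |x - y| := by
    apply max_le
    · linarith
    · have := neg_abs_le (x - y)
      have : y ≤ x + |x - y| := by linarith
      linarith
  have k1 : ((1 - s) * y / (x + √s)) ≤ y / √s := by
    gcongr
    · nlinarith
    · linarith
  have k2 : x / (x + √s) ≤ 1 := by rw [div_le_one (by positivity)]; linarith
  have k3 : Real.exp (-qq s x y) ≤ 2 * Real.exp (-(1 / (128 * 441)) * (M / √s) ^ 2) := by
    calc Real.exp (-qq s x y) ≤ Real.exp (-(qq s x y / 2)) := by rw [Real.exp_le_exp]; linarith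
      _ ≤ 2 * Real.exp (-(x - y) ^ 2 / (128 * s)) := qlow hs hs2 hsx
      _ ≤ _ := by
        gcongr
        rw [div_pow, Real.sq_sqrt hs.le, neg_div, neg_mul, neg_le_neg_iff]
        have : M ^ 2 ≤ 441 * (x - y) ^ 2 := by
          rw [← sq_abs (x - y)]
          calc M ^ 2 ≤ (21 * |x - y|) ^ 2 := by gcongr
            _ = _ := by ring
        rw [one_div_mul_eq_div, div_div, div_le_div_iff₀ (by positivity) (by positivity)]
        nlinarith
  set u := M / √s with hu
  have hu0 : 0 < u := by positivity
  have hYu : y / √s ≤ u := by rw [hu]; gcongr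
  have k4 : (y / √s) ^ (2 * β) ≤ (y / √s) * (u ^ (2 * β + 1) / u ^ 2) := by
    have e1 : (y / √s) ^ (2 * β) = (y / √s) * (y / √s) ^ (2 * β - 1) := by
      rw [Real.rpow_sub (by positivity), Real.rpow_one]; field_simp
    have e2 : u ^ (2 * β + 1) / u ^ 2 = u ^ (2 * β - 1) := by
      rw [← Real.rpow_natCast u 2, ← Real.rpow_sub hu0]; congr 1; push_cast; ring
    rw [e1, e2]
    gcongr
    linarith
  have k5 := h u hu0.le
  have k6 := (NN_ge b hx hy).2.2
  have k7 : y / M ^ 2 ≤ 2 * (y⁻¹ * (1 + (y⁻¹ * x) ^ 2)⁻¹) := by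
    have : 2 * (y⁻¹ * (1 + (y⁻¹ * x) ^ 2)⁻¹) = 2 * y / (x ^ 2 + y ^ 2) := by field_simp; ring
    rw [this, div_le_div_iff₀ (by positivity) (by positivity)]
    have a1 : x ^ 2 ≤ M ^ 2 := by gcongr
    have a2 : y ^ 2 ≤ M ^ 2 := by gcongr
    nlinarith
  calc _ ≤ (√s)⁻¹ * ((y / √s) * (u ^ (2 * β + 1) / u ^ 2)) * 1 *
        (2 * Real.exp (-(1 / (128 * 441)) * u ^ 2)) := by
        gcongr
        exact (Real.rpow_le_rpow (by positivity) k1 (by linarith)).trans k4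
    _ = 2 * ((√s)⁻¹ * (y / √s) / u ^ 2) * (u ^ (2 * β + 1) * Real.exp (-(1 / (128 * 441)) * u ^ 2)) := by ring
    _ ≤ 2 * ((√s)⁻¹ * (y / √s) / u ^ 2) * C := by gcongr
    _ = 2 * C * (y / M ^ 2) := by rw [hu]; field_simp
    _ ≤ 2 * C * (2 * NN b x y) := by gcongr; linarith
    _ = _ := by ring


noncomputable def Nk (a b C x y : ℝ) : ENNReal := ENNReal.ofReal (C * NN b x y / w1 a x)

theorem Nk_meas (a b C : ℝ) : Measurable (fun p : ℝ × ℝ => Nk a b C p.1 p.2) := by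
  unfold Nk
  exact (((NN_meas b).const_mul C).div ((w1_meas a).comp measurable_fst)).ennreal_ofReal

theorem nu1_lint (a : ℝ) (g : ℝ → ENNReal) (hg : Measurable g) :
    ∫⁻ x, g x ∂(nu1 a) = ∫⁻ x in Set.Ioi 0, ENNReal.ofReal (w1 a x) * g x := by
  rw [nu1, lintegral_withDensity_eq_lintegral_mul _ (w1_meas a).ennreal_ofReal hg]
  rfl

theorem Nk_int (a b C : ℝ) (hb : b < 1) (hC : 0 < C) : ∃ CN : ENNReal, CN ≠ ⊤ ∧ ∀ y, 0 < y →
    ∫⁻ x, Nk a b C x y ∂(nu1 a) ≤ CN := by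
  obtain ⟨C1, h1, h⟩ := NN_int b hb
  refine ⟨ENNReal.ofReal C * C1, ENNReal.mul_ne_top ENNReal.ofReal_ne_top h1, fun y hy => ?_⟩
  have m0 : Measurable (fun x => NN b x y) :=
    (NN_meas b).comp (show Measurable fun x : ℝ => (x, y) by fun_prop)
  have m1 : Measurable (fun x => Nk a b C x y) := by
    unfold Nk
    exact ((m0.const_mul C).div (w1_meas a)).ennreal_ofReal
  have m2 : Measurable (fun x => ENNReal.ofReal (NN b x y)) :=
    ((NN_meas b).comp (show Measurable fun x : ℝ => (x, y) by fun_prop)).ennreal_ofReal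
  calc ∫⁻ x, Nk a b C x y ∂(nu1 a) = ∫⁻ x in Set.Ioi 0, ENNReal.ofReal (w1 a x) * Nk a b C x y :=
        nu1_lint a _ m1
    _ ≤ ∫⁻ x in Set.Ioi 0, ENNReal.ofReal C * ENNReal.ofReal (NN b x y) := by
        refine setLIntegral_mono' measurableSet_Ioi fun x hx => ?_
        have hx0 : 0 < x := hx
        have hw := w1_pos a hx0
        have e : w1 a x * (C * NN b x y / w1 a x) = C * NN b x y := by field_simp
        rw [Nk, ← ENNReal.ofReal_mul hw.le, ← ENNReal.ofReal_mul hC.le, e]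
    _ = ENNReal.ofReal C * ∫⁻ x in Set.Ioi 0, ENNReal.ofReal (NN b x y) :=
        lintegral_const_mul _ m2
    _ ≤ _ := mul_le_mul' le_rfl (h y hy)

theorem Nk_le {a b C x y k : ℝ} (hx : 0 < x) (h : k * w1 a x ≤ C * NN b x y) :
    ENNReal.ofReal k ≤ Nk a b C x y := by
  apply ENNReal.ofReal_le_ofReal
  rwa [le_div_iff₀ (w1_pos a hx)]

def CoordB (a : ℝ) (k : ℝ → ℝ → ℝ → ℝ) : Prop :=
  ∃ (κ : ℝ → ℝ) (N : ℝ → ℝ → ENNReal) (D CN : ENNReal) (Cl : ℝ) (m : ℕ),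
    Geo (nu1 a) κ D ∧ D ≠ ⊤ ∧ Measurable (fun p : ℝ × ℝ => N p.1 p.2) ∧ CN ≠ ⊤ ∧
    (∀ y, 0 < y → ∫⁻ x, N x y ∂(nu1 a) ≤ CN) ∧ 1 ≤ Cl ∧
    ∀ s x y, 0 < s → s < 1 → 0 < x → 0 < y → s * x ^ 2 ≤ 1 →
      ENNReal.ofReal (k s x y) ≤ N x y ∨ (|x - y| ≤ κ x ∧ ∀ t, √s ≤ t → |x - y| ≤ t →
        ENNReal.ofReal (k s x y) * vol1 (nu1 a) κ t x ≤
          ENNReal.ofReal (Cl * (t / √s) ^ m * Real.exp (-(x - y) ^ 2 / (128 * s))))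

theorem root_le_kapg {s x : ℝ} (hs : 0 < s) (hs1 : s < 1) (hx : 0 < x) (hsx : s * x ^ 2 ≤ 1) :
    √s ≤ kapg x := by
  unfold kapg
  have hr : 0 < √s := Real.sqrt_pos.2 hs
  rw [le_div_iff₀ (by positivity), mul_max_of_nonneg _ _ hr.le, mul_one]
  apply max_le
  · rw [Real.sqrt_le_one]; exact hs1.le
  · have : (√s * x) ^ 2 ≤ 1 ^ 2 := by rw [mul_pow, Real.sq_sqrt hs.le]; linarith
    exact le_of_sq_le_sq this (by norm_num)

theorem vol_le {a x τ : ℝ} (hτ : 0 ≤ τ) :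
    nu1 a (Set.Icc (x - τ) (x + τ)) ≤ nu1 a (Set.Icc (x - 7 * τ) (x + 7 * τ)) :=
  measure_mono (Set.Icc_subset_Icc (by linarith) (by linarith))

theorem coordB_good (a : ℝ) (ha : -1 < a) : CoordB a (kg a) := by
  obtain ⟨D, hD, hgeo⟩ := geo_good a ha
  have hb0 : 0 ≤ max 0 (-a) := le_max_left _ _
  obtain ⟨C1, hC1, h1⟩ := nonloc (max 0 (-a)) hb0
  obtain ⟨CN, hCN, hN⟩ := Nk_int a (max 0 (-a)) C1 (max_lt (by norm_num) (by linarith)) (by linarith)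
  obtain ⟨C2, hC2, h2⟩ := meas_up a
  refine ⟨kapg, Nk a (max 0 (-a)) C1, D, CN, 1 + 2 * C2, ⌈|a|⌉₊ + 1, hgeo, hD, Nk_meas _ _ _, hCN, hN,
    by linarith, fun s x y hs hs1 hx hy hsx => ?_⟩
  by_cases hc : 1 / 2 ≤ s ∨ kapg x < |x - y|
  · left
    exact Nk_le hx ((ub_good a hs hx).trans (h1 s x y hs hs1 hx hy hsx hc))
  · right
    push Not at hc
    refine ⟨hc.2, fun t ht hDt => ?_⟩
    have hr : 0 < √s := Real.sqrt_pos.2 hs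
    have hrk := root_le_kapg hs hs1 hx hsx
    unfold vol1
    set τ := min t (kapg x) with hτ
    have hrτ : √s ≤ τ := le_min ht hrk
    have hτ0 : 0 < τ := hr.trans_le hrτ
    have hτt : τ ≤ t := min_le_left _ _
    have hτk : τ ≤ kapg x := min_le_right _ _
    have hm : 1 ≤ τ / √s := by rwa [one_le_div hr]
    have key := (vol_le (a := a) (x := x) hτ0.le).trans (h2 x τ hx hτ0 (hτk.trans (kapg_le x))
      (by nlinarith [kapg_mul x]) (Or.inr ha))
    refine (mul_le_mul' le_rfl key).trans ?_
    have hkn : 0 ≤ kg a s x y := by unfold kg; positivity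
    rw [← ENNReal.ofReal_mul hkn]
    apply ENNReal.ofReal_le_ofReal
    have hq := qq_nonneg hs x y
    have e1 : Real.exp (-(qq s x y)) ≤ 2 * Real.exp (-(x - y) ^ 2 / (128 * s)) :=
      le_trans (by rw [Real.exp_le_exp]; linarith) (qlow (y := y) hs hc.1.le hsx)
    have e2 : (x + τ) ^ a ≤ (τ / √s) ^ |a| * (x + √s) ^ a := by
      apply rpow_ratio' a hm (by positivity)
      · have : x + τ ≤ τ / √s * (x + τ) := by nlinarith
        linarith
      · rw [div_mul_eq_mul_div, le_div_iff₀ hr]; nlinarith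
    have e3 : (τ / √s) ^ |a| ≤ (t / √s) ^ ⌈|a|⌉₊ := by
      calc (τ / √s) ^ |a| ≤ (τ / √s) ^ ((⌈|a|⌉₊ : ℕ) : ℝ) :=
            Real.rpow_le_rpow_of_exponent_le hm (Nat.le_ceil _)
        _ = (τ / √s) ^ ⌈|a|⌉₊ := Real.rpow_natCast _ _
        _ ≤ _ := by gcongr
    have e4 : (x + √s) ^ (-a) * (x + √s) ^ a = 1 := by
      rw [← Real.rpow_add (by positivity)]; simp
    have e5 : Real.exp (x ^ 2 - qq s x y) * Real.exp (-x ^ 2) = Real.exp (-qq s x y) := by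
      rw [← Real.exp_add]; congr 1; ring
    have htp : 0 < t := by linarith
    unfold kg
    calc _ = C2 * (τ / √s) * ((x + √s) ^ (-a) * (x + τ) ^ a) *
          (Real.exp (x ^ 2 - qq s x y) * Real.exp (-x ^ 2)) := by ring
      _ ≤ C2 * (t / √s) * ((x + √s) ^ (-a) * ((t / √s) ^ ⌈|a|⌉₊ * (x + √s) ^ a)) *
          (2 * Real.exp (-(x - y) ^ 2 / (128 * s))) := by
          rw [e5]
          have := e2.trans (mul_le_mul_of_nonneg_right e3 (by positivity : 0 ≤ (x + √s) ^ a))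
          gcongr
      _ = 2 * C2 * (t / √s) ^ (⌈|a|⌉₊ + 1) * ((x + √s) ^ (-a) * (x + √s) ^ a) *
          Real.exp (-(x - y) ^ 2 / (128 * s)) := by ring
      _ ≤ _ := by
          rw [e4, mul_one]; gcongr; linarith

theorem coordB_bad (β : ℝ) (hβ : 1 ≤ β) : CoordB (1 - 2 * β) (kb β) := by
  obtain ⟨D, hD, hgeo⟩ := geo_bad (1 - 2 * β)
  obtain ⟨C0, hC0, h0⟩ := ub_bad β hβ
  obtain ⟨C1, hC1, h1⟩ := nonloc 0 le_rfl
  obtain ⟨C3, hC3, h3⟩ := nonloc_bad β 0 hβ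
  obtain ⟨CN, hCN, hN⟩ := Nk_int (1 - 2 * β) 0 (C0 * C1 + C3) (by norm_num) (by nlinarith)
  obtain ⟨C2, hC2, h2⟩ := meas_up (1 - 2 * β)
  set a := 1 - 2 * β with ha
  refine ⟨kapb, Nk a 0 (C0 * C1 + C3), D, CN, 1 + 2 * C0 * C2 * 2 ^ |a|, 1, hgeo, hD, Nk_meas _ _ _,
    hCN, hN, by
      have : 0 ≤ 2 * C0 * C2 * 2 ^ |a| := by positivity
      linarith, fun s x y hs hs1 hx hy hsx => ?_⟩
  have hNN := NN_nonneg 0 hx hy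
  by_cases hc : 1 / 2 ≤ s ∨ kapg x < |x - y|
  · left
    refine Nk_le hx ((h0 s x y hs hs1 hx hy).trans ?_)
    have := h1 s x y hs hs1 hx hy hsx hc
    nlinarith
  by_cases hc2 : x / 20 < |x - y|
  · left
    push Not at hc
    refine Nk_le hx ((h3 s x y hs hc.1.le hx hy hsx hc2).trans ?_)
    have : 0 ≤ C0 * C1 := by nlinarith
    nlinarith
  · right
    push Not at hc hc2
    refine ⟨le_min hc.2 hc2, fun t ht hDt => ?_⟩
    have hr : 0 < √s := Real.sqrt_pos.2 hs
    have htp : 0 < t := by linarith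
    unfold vol1
    have hkp := hgeo.pos x hx
    set τ := min t (kapb x) with hτ
    have hτ0 : 0 < τ := lt_min htp hkp
    have hτt : τ ≤ t := min_le_left _ _
    have hτk : τ ≤ kapg x := (min_le_right _ _).trans (min_le_left _ _)
    have hτx : τ ≤ x / 20 := (min_le_right _ _).trans (min_le_right _ _)
    have key := (vol_le (a := a) (x := x) hτ0.le).trans (h2 x τ hx hτ0 (hτk.trans (kapg_le x))
      (by nlinarith [kapg_mul x]) (Or.inl (by linarith)))
    refine (mul_le_mul' le_rfl key).trans ?_
    have h1s : 0 < 1 - s := by linarith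
    have hkn : 0 ≤ kb β s x y := by unfold kb kg; positivity
    rw [← ENNReal.ofReal_mul hkn]
    apply ENNReal.ofReal_le_ofReal
    have e1 := qlow (y := y) hs hc.1.le hsx
    have e2 : (x + τ) ^ a ≤ 2 ^ |a| * x ^ a := by
      apply rpow_ratio' a (by norm_num) hx <;> linarith
    have e6 := h0 s x y hs hs1 hx hy
    unfold UU at e6
    rw [Real.rpow_zero, mul_one] at e6
    calc kb β s x y * (C2 * ((x + τ) ^ a * τ * Real.exp (-x ^ 2)))
        ≤ kb β s x y * (C2 * ((2 ^ |a| * x ^ a) * t * Real.exp (-x ^ 2))) := by gcongr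
      _ = C2 * 2 ^ |a| * t * (kb β s x y * w1 a x) := by unfold w1; ring
      _ ≤ C2 * 2 ^ |a| * t * (C0 * ((√s)⁻¹ * (2 * Real.exp (-(x - y) ^ 2 / (128 * s))))) := by
          refine mul_le_mul_of_nonneg_left ?_ (by positivity)
          exact e6.trans (by gcongr)
      _ = 2 * C0 * C2 * 2 ^ |a| * (t / √s) ^ 1 * Real.exp (-(x - y) ^ 2 / (128 * s)) := by
          rw [pow_one]; ring
      _ ≤ _ := by
          gcongr; linarith

theorem regB' {d : ℕ} (a : Fin d → ℝ) (k : Fin d → ℝ → ℝ → ℝ → ℝ)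
    (h : ∀ i, CoordB (a i) (k i)) :
    ∃ C : ENNReal, C ≠ ⊤ ∧ ∀ (μ : Measure (Fin d → ℝ)) [IsFiniteMeasure μ],
      (∀ᵐ y ∂μ, ∀ i, 0 < y i) → ∀ lam : ENNReal,
      lam * Measure.pi (fun i => nu1 (a i)) {x | (∀ i, 0 < x i) ∧ ∃ s : ℝ, 0 < s ∧ s < 1 ∧
        (∀ i, s * x i ^ 2 ≤ 1) ∧ lam < ∫⁻ y, ∏ i, ENNReal.ofReal (k i s (x i) (y i)) ∂μ} ≤
          C * μ Set.univ := by
  choose κ N D CN Cl m h1 h2 h3 h4 h5 h6 h7 using h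
  have hCl0 : ∀ i, 0 ≤ Cl i := fun i => by linarith [h6 i]
  refine regB (fun i => nu1 (a i)) κ N D h1 h2 h3 CN h4 h5
    (fun i s x y => ENNReal.ofReal (k i s x y)) (1 + ∑ i, Cl i) ?_ (∑ i, m i) ?_
  · have := Finset.sum_nonneg (s := Finset.univ) fun i _ => hCl0 i
    linarith
  · intro i s x y hs hs1 hx hy hsx
    refine (h7 i s x y hs hs1 hx hy hsx).imp_right fun hh => ⟨hh.1, fun t ht hDt => ?_⟩
    refine (hh.2 t ht hDt).trans (ENNReal.ofReal_le_ofReal ?_)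
    have hr : 0 < √s := Real.sqrt_pos.2 hs
    have hm : 1 ≤ t / √s := by rwa [one_le_div hr]
    have e1 : Cl i ≤ 1 + ∑ i, Cl i := by
      have := Finset.single_le_sum (fun i _ => hCl0 i) (Finset.mem_univ i)
      linarith
    have e2 : m i ≤ ∑ i, m i := Finset.single_le_sum (fun i _ => Nat.zero_le _) (Finset.mem_univ i)
    have e3 : (t / √s) ^ m i ≤ (t / √s) ^ (∑ i, m i) := pow_le_pow_right₀ hm e2
    have := hCl0 i
    have := this.trans e1
    gcongr


noncomputable def AA {n : ℕ} (b : Fin n → ℝ) (ρ σ s Y : ℝ) (z v : Fin n → ℝ) : ℝ :=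
  (ρ ^ 2)⁻¹ * (σ⁻¹) ^ (n + 1) * (∏ i, (1 + σ / z i) ^ b i) *
    Real.exp (-((1 - (1 - s) / (1 + s) * Y / ρ) ^ 2 +
      ∑ i, (z i - (1 - s) / (1 + s) * v i / ρ) ^ 2) / (16 * σ ^ 2))

set_option maxHeartbeats 1600000 in
theorem ptA (n : ℕ) (b : Fin n → ℝ) (hb : ∀ i, 0 ≤ b i) (hb1 : ∀ i, b i ≤ 1) :
    ∃ C : ℝ, 0 < C ∧ ∀ (ρ σ s Y : ℝ) (z v : Fin n → ℝ), 1 ≤ ρ → 0 < σ → σ ≤ 1 → 1 ≤ σ * ρ ^ 2 →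
      s = σ ^ 2 * ρ ^ 2 → s < 1 → 0 < Y → (∀ i, 0 < z i) → (∀ i, z i ≤ 1) →
      AA b ρ σ s Y z v ≤ C * ∏ i, z i ^ (-b i) ∨
      ∃ (k : ℕ) (κ : ℝ), 0 ≤ κ ∧ (κ = (1 / 2) ^ k ∨ ((2 : ℝ) ^ k ≤ 4 * Y ^ 2 ∧ κ = 2 ^ k / Y ^ 2)) ∧
        AA b ρ σ s Y z v ≤ C * (κ * ∏ i, (2 ^ k * ((1 + 1 / (2 ^ k * z i)) ^ b i *
          Real.exp (-(1 / (64 * (n + 1))) * (2 ^ k * z i - 2 ^ k * (v i / Y)) ^ 2)))) := by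
  obtain ⟨C1, hC1, h1⟩ := pow_exp_bdd (n + 1) (1 / 256) (by norm_num)
  have h2n : (1 : ℝ) ≤ 2 ^ n := one_le_pow₀ (by norm_num)
  refine ⟨2 ^ n * C1 + 16 * 2 ^ n, by positivity, ?_⟩
  intro ρ σ s Y z v hρ hσ hσ1 hσρ hs hs1 hY hz hz1
  have hρ0 : 0 < ρ := by linarith
  have hs0 : 0 < s := by rw [hs]; positivity
  set r := (1 - s) / (1 + s) with hr
  have hr0 : 0 < r := div_pos (by linarith) (by linarith)
  have hr1 : r < 1 := by rw [hr, div_lt_one (by linarith)]; linarith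
  set u := r * Y / ρ with hu
  have hSn : 0 ≤ ∑ i, (z i - r * v i / ρ) ^ 2 := Finset.sum_nonneg fun i _ => sq_nonneg _
  have hbase : ∀ i, 1 ≤ 1 + σ / z i := fun i => by
    have := div_pos hσ (hz i); linarith
  by_cases hc : 1 / 4 ≤ |1 - u|
  · left
    have e1 : Real.exp (-((1 - u) ^ 2 + ∑ i, (z i - r * v i / ρ) ^ 2) / (16 * σ ^ 2)) ≤
        Real.exp (-(1 / 256) * (σ⁻¹) ^ 2) := by
      rw [Real.exp_le_exp, inv_pow, neg_div, neg_mul, neg_le_neg_iff, one_div_mul_eq_div,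
        ← one_div, div_div, div_le_div_iff₀ (by positivity) (by positivity)]
      have : 1 / 16 ≤ (1 - u) ^ 2 := by rw [← sq_abs]; nlinarith
      nlinarith [sq_nonneg σ]
    have e2 : ∏ i, (1 + σ / z i) ^ b i ≤ 2 ^ n * ∏ i, z i ^ (-b i) := by
      have : (2 : ℝ) ^ n = ∏ i : Fin n, (2 : ℝ) := by simp
      rw [this, ← Finset.prod_mul_distrib]
      refine Finset.prod_le_prod (fun i _ => by have := hbase i; positivity) fun i _ => ?_
      have hzi := hz i
      calc (1 + σ / z i) ^ b i ≤ (2 / z i) ^ b i := by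
            apply Real.rpow_le_rpow (by linarith [hbase i]) _ (hb i)
            rw [show 1 + σ / z i = (z i + σ) / z i by field_simp]
            gcongr; linarith [hz1 i]
        _ = 2 ^ b i * z i ^ (-b i) := by
            rw [Real.div_rpow (by norm_num) hzi.le, Real.rpow_neg hzi.le, div_eq_mul_inv]
        _ ≤ _ := by
            gcongr
            calc (2 : ℝ) ^ b i ≤ 2 ^ (1 : ℝ) := Real.rpow_le_rpow_of_exponent_le (by norm_num) (hb1 i)
              _ = 2 := Real.rpow_one _
    have e3 : (ρ ^ 2)⁻¹ ≤ 1 := inv_le_one_of_one_le₀ (one_le_pow₀ hρ)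
    have e4 := h1 σ⁻¹ (by positivity)
    have hP : 0 ≤ ∏ i, z i ^ (-b i) := Finset.prod_nonneg fun i _ => by have := hz i; positivity
    have hP2 : 0 ≤ ∏ i, (1 + σ / z i) ^ b i := Finset.prod_nonneg fun i _ => by
      have := hbase i; positivity
    unfold AA
    calc _ ≤ 1 * (σ⁻¹) ^ (n + 1) * (2 ^ n * ∏ i, z i ^ (-b i)) * Real.exp (-(1 / 256) * (σ⁻¹) ^ 2) := by
          gcongr
      _ = 2 ^ n * ((σ⁻¹) ^ (n + 1) * Real.exp (-(1 / 256) * (σ⁻¹) ^ 2)) * ∏ i, z i ^ (-b i) := by ring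
      _ ≤ 2 ^ n * C1 * ∏ i, z i ^ (-b i) := by gcongr
      _ ≤ _ := by gcongr; linarith [h2n]
  · right
    push Not at hc
    rw [abs_lt] at hc
    have hu1 : 3 / 4 < u := by linarith
    have hu2 : u < 5 / 4 := by linarith
    have huY : u * ρ = r * Y := by rw [hu]; field_simp
    have hρY : ρ ≤ 2 * Y := by nlinarith
    obtain ⟨k, hk1, hk2⟩ := exists_nat_pow_near (one_le_inv_iff₀.2 ⟨hσ, hσ1⟩) (one_lt_two (α := ℝ))
    have h2k : (0 : ℝ) < 2 ^ k := by positivity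
    have hk3 : σ ≤ (1 / 2) ^ k := by
      rw [one_div, inv_pow, le_inv_comm₀ hσ h2k]; exact hk1
    have hk4 : σ * 2 ^ k ≤ 1 := by
      rw [one_div, inv_pow, ← one_div, le_div_iff₀ h2k] at hk3; exact hk3
    -- choose kappa
    obtain ⟨κ, hκ0, hκ, hκle⟩ : ∃ κ : ℝ, 0 ≤ κ ∧ (κ = (1 / 2) ^ k ∨
        ((2 : ℝ) ^ k ≤ 4 * Y ^ 2 ∧ κ = 2 ^ k / Y ^ 2)) ∧ (ρ ^ 2)⁻¹ * σ⁻¹ ≤ 8 * κ := by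
      by_cases hρ2 : Y / 2 ≤ ρ
      · refine ⟨2 ^ k / Y ^ 2, by positivity, Or.inr ⟨?_, rfl⟩, ?_⟩
        · refine hk1.trans ?_
          rw [← one_div, div_le_iff₀ hσ]
          nlinarith
        · have e1 : (ρ ^ 2)⁻¹ ≤ 4 / Y ^ 2 := by
            rw [← one_div, div_le_div_iff₀ (by positivity) (by positivity)]
            nlinarith
          have e2 : σ⁻¹ ≤ 2 * 2 ^ k := by rw [pow_succ] at hk2; linarith
          calc _ ≤ 4 / Y ^ 2 * (2 * 2 ^ k) := by gcongr
            _ = _ := by ring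
      · push Not at hρ2
        refine ⟨(1 / 2) ^ k, by positivity, Or.inl rfl, ?_⟩
        have hr2 : r < 5 / 8 := by nlinarith
        have hs3 : 3 / 13 < s := by
          rw [hr, div_lt_iff₀ (by linarith)] at hr2; linarith
        have e1 : (ρ ^ 2)⁻¹ * σ⁻¹ = σ / s := by rw [hs]; field_simp
        rw [e1, div_le_iff₀ hs0]
        nlinarith
    refine ⟨k, κ, hκ0, hκ, ?_⟩
    have e1 : Real.exp (-((1 - u) ^ 2 + ∑ i, (z i - r * v i / ρ) ^ 2) / (16 * σ ^ 2)) ≤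
        ∏ i, Real.exp (-(1 / (64 * (n + 1))) * (2 ^ k * z i - 2 ^ k * (v i / Y)) ^ 2) := by
      rw [← Real.exp_sum, Real.exp_le_exp, ← Finset.mul_sum]
      have q1 : ∀ i, (z i - v i / Y) ^ 2 ≤ 4 * (1 - u) ^ 2 + 4 * (z i - r * v i / ρ) ^ 2 := by
        intro i
        have e : z i - v i / Y = ((z i - r * v i / ρ) - (1 - u) * z i) / u := by
          rw [hu]; field_simp; ring
        have hzi := hz i
        have hzi1 := hz1 i
        rw [e, div_pow, div_le_iff₀ (by positivity)]
        have a1 : ((1 - u) * z i) ^ 2 ≤ (1 - u) ^ 2 := by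
          rw [mul_pow]
          exact mul_le_of_le_one_right (sq_nonneg _) (pow_le_one₀ hzi.le hzi1)
        have a2 : 1 / 2 ≤ u ^ 2 := by nlinarith
        generalize z i - r * v i / ρ = A at *
        generalize (1 - u) * z i = B at *
        have a3 : (A - B) ^ 2 ≤ 2 * A ^ 2 + 2 * (1 - u) ^ 2 := by nlinarith [sq_nonneg (A + B)]
        have a4 : (4 * (1 - u) ^ 2 + 4 * A ^ 2) * (1 / 2) ≤ (4 * (1 - u) ^ 2 + 4 * A ^ 2) * u ^ 2 :=
          mul_le_mul_of_nonneg_left a2 (by positivity)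
        linarith
      have q2 : ∑ i, (z i - v i / Y) ^ 2 ≤ 4 * n * (1 - u) ^ 2 + 4 * ∑ i, (z i - r * v i / ρ) ^ 2 := by
        refine (Finset.sum_le_sum fun i _ => q1 i).trans (le_of_eq ?_)
        rw [Finset.sum_add_distrib, Finset.mul_sum, Finset.sum_const, Finset.card_univ,
          Fintype.card_fin, nsmul_eq_mul]
        ring
      have q3 : ∑ i, (2 ^ k * z i - 2 ^ k * (v i / Y)) ^ 2 = (2 ^ k) ^ 2 * ∑ i, (z i - v i / Y) ^ 2 := by
        rw [Finset.mul_sum]; exact Finset.sum_congr rfl fun i _ => by ring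
      rw [q3]
      have hS2 : 0 ≤ ∑ i, (z i - v i / Y) ^ 2 := Finset.sum_nonneg fun i _ => sq_nonneg _
      have q4 : (σ * 2 ^ k) ^ 2 ≤ 1 := pow_le_one₀ (by positivity) hk4
      have hn0 : (0 : ℝ) ≤ n := Nat.cast_nonneg n
      rw [neg_div, neg_mul, neg_le_neg_iff, one_div_mul_eq_div,
        div_le_div_iff₀ (by positivity) (by positivity)]
      set S1 := ∑ i, (z i - r * v i / ρ) ^ 2
      set S2 := ∑ i, (z i - v i / Y) ^ 2
      calc (2 ^ k) ^ 2 * S2 * (16 * σ ^ 2) = 16 * ((σ * 2 ^ k) ^ 2 * S2) := by ring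
        _ ≤ 16 * (1 * S2) := by gcongr
        _ ≤ _ := by nlinarith [sq_nonneg (1 - u), mul_nonneg hn0 hSn]
    have e2 : ∏ i, (1 + σ / z i) ^ b i ≤ ∏ i, (1 + 1 / (2 ^ k * z i)) ^ b i := by
      refine Finset.prod_le_prod (fun i _ => by have := hbase i; positivity) fun i _ => ?_
      have hzi := hz i
      apply Real.rpow_le_rpow (by linarith [hbase i]) _ (hb i)
      gcongr 1 + ?_
      rw [div_le_div_iff₀ hzi (by positivity)]
      nlinarith
    have e3 : (σ⁻¹) ^ n ≤ 2 ^ n * ∏ i : Fin n, (2 : ℝ) ^ k := by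
      rw [Finset.prod_const, Finset.card_univ, Fintype.card_fin, ← mul_pow]
      gcongr
      rw [pow_succ] at hk2; linarith
    have hP2 : 0 ≤ ∏ i, (1 + σ / z i) ^ b i := Finset.prod_nonneg fun i _ => by
      have := hbase i; positivity
    have hP3 : 0 ≤ ∏ i, (1 + 1 / (2 ^ k * z i)) ^ b i := hP2.trans e2
    unfold AA
    rw [Finset.prod_mul_distrib, Finset.prod_mul_distrib]
    have hP4 : (0 : ℝ) ≤ ∏ i : Fin n, (2 : ℝ) ^ k := by positivity
    calc _ = ((ρ ^ 2)⁻¹ * σ⁻¹) * (σ⁻¹) ^ n * (∏ i, (1 + σ / z i) ^ b i) *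
          Real.exp (-((1 - u) ^ 2 + ∑ i, (z i - r * v i / ρ) ^ 2) / (16 * σ ^ 2)) := by
          rw [pow_succ]; ring
      _ ≤ (8 * κ) * (2 ^ n * ∏ i : Fin n, (2 : ℝ) ^ k) * (∏ i, (1 + 1 / (2 ^ k * z i)) ^ b i) *
          ∏ i, Real.exp (-(1 / (64 * (n + 1))) * (2 ^ k * z i - 2 ^ k * (v i / Y)) ^ 2) := by
          gcongr
      _ = (8 * 2 ^ n) * (κ * ((∏ i : Fin n, (2 : ℝ) ^ k) * ((∏ i, (1 + 1 / (2 ^ k * z i)) ^ b i) *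
          ∏ i, Real.exp (-(1 / (64 * (n + 1))) * (2 ^ k * z i - 2 ^ k * (v i / Y)) ^ 2)))) := by ring
      _ ≤ _ := by
          have : 0 ≤ ∏ i, Real.exp (-(1 / (64 * (n + 1))) * (2 ^ k * z i - 2 ^ k * (v i / Y)) ^ 2) :=
            Finset.prod_nonneg fun i _ => (Real.exp_pos _).le
          apply mul_le_mul_of_nonneg_right _ (by positivity)
          nlinarith


noncomputable def P1f (b w : ℝ) : ENNReal := if 0 < w ∧ w ≤ 1 then ENNReal.ofReal (w ^ (-b)) else 0
noncomputable def G1f (b c η w : ℝ) : ENNReal :=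
  if 0 < w then ENNReal.ofReal ((1 + 1 / w) ^ b * Real.exp (-c * (w - η) ^ 2)) else 0

theorem P1f_meas (b : ℝ) : Measurable (P1f b) := by
  unfold P1f
  refine Measurable.ite ?_ (by fun_prop) measurable_const
  exact measurableSet_Ioc

theorem G1f_meas (b c : ℝ) : Measurable (fun p : ℝ × ℝ => G1f b c p.1 p.2) := by
  unfold G1f
  refine Measurable.ite ?_ (by fun_prop) measurable_const
  exact measurableSet_lt measurable_const measurable_snd

theorem P1f_int {b : ℝ} (hb : b < 1) : ∫⁻ w, P1f b w ≠ ⊤ := by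
  have h := intervalIntegral.intervalIntegrable_rpow' (a := 0) (b := 1) (r := -b) (by linarith)
  rw [intervalIntegrable_iff_integrableOn_Ioc_of_le zero_le_one] at h
  have e : ∫⁻ w, P1f b w = ∫⁻ w in Set.Ioc (0:ℝ) 1, ENNReal.ofReal (w ^ (-b)) := by
    rw [← lintegral_indicator measurableSet_Ioc]
    refine lintegral_congr fun w => ?_
    unfold P1f
    by_cases hw : 0 < w ∧ w ≤ 1
    · rw [if_pos hw, Set.indicator_of_mem (Set.mem_Ioc.2 hw)]
    · rw [if_neg hw, Set.indicator_of_notMem (fun h => hw (Set.mem_Ioc.1 h))]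
  rw [e]
  exact (Integrable.lintegral_lt_top h).ne

theorem G1f_int {b c : ℝ} (hb0 : 0 ≤ b) (hb : b < 1) (hc : 0 < c) :
    ∃ C : ENNReal, C ≠ ⊤ ∧ ∀ η, ∫⁻ w, G1f b c η w ≤ C := by
  refine ⟨2 * (∫⁻ w, P1f b w) + 2 * ∫⁻ w : ℝ, ENNReal.ofReal (Real.exp (-c * w ^ 2)), ?_, ?_⟩
  · have := P1f_int hb
    have h2 := (Integrable.lintegral_lt_top (integrable_exp_neg_mul_sq hc)).ne
    exact ENNReal.add_ne_top.2 ⟨ENNReal.mul_ne_top (by simp) this, ENNReal.mul_ne_top (by simp) h2⟩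
  · intro η
    have hle : ∀ w, G1f b c η w ≤ 2 * P1f b w + 2 * ENNReal.ofReal (Real.exp (-c * (w - η) ^ 2)) := by
      intro w
      unfold G1f P1f
      split_ifs with h0 h1
      · refine le_add_right ?_
        rw [← ENNReal.ofReal_ofNat, ← ENNReal.ofReal_mul (by norm_num)]
        apply ENNReal.ofReal_le_ofReal
        have e1 : (1 + 1 / w) ^ b ≤ 2 * w ^ (-b) := by
          calc (1 + 1 / w) ^ b ≤ (2 / w) ^ b := by
                apply Real.rpow_le_rpow (by positivity) _ hb0
                rw [show 1 + 1 / w = (w + 1) / w by field_simp]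
                gcongr; linarith [h1.2]
            _ = 2 ^ b * w ^ (-b) := by
                rw [Real.div_rpow (by norm_num) h0.le, Real.rpow_neg h0.le, div_eq_mul_inv]
            _ ≤ _ := by
                gcongr
                calc (2 : ℝ) ^ b ≤ 2 ^ (1 : ℝ) := Real.rpow_le_rpow_of_exponent_le (by norm_num) hb.le
                  _ = 2 := Real.rpow_one _
        calc _ ≤ (2 * w ^ (-b)) * 1 := by
              apply mul_le_mul e1 _ (Real.exp_pos _).le (by positivity)
              rw [Real.exp_le_one_iff]; nlinarith [sq_nonneg (w - η)]
          _ = _ := by ring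
      · refine le_add_left ?_
        rw [← ENNReal.ofReal_ofNat, ← ENNReal.ofReal_mul (by norm_num)]
        apply ENNReal.ofReal_le_ofReal
        gcongr
        have hw : 1 ≤ w := by by_contra h; exact h1 ⟨h0, by linarith⟩
        calc (1 + 1 / w) ^ b ≤ 2 ^ b := by
              apply Real.rpow_le_rpow (by positivity) _ hb0
              have : 1 / w ≤ 1 := by rw [div_le_one h0]; exact hw
              linarith
          _ ≤ 2 ^ (1 : ℝ) := Real.rpow_le_rpow_of_exponent_le (by norm_num) hb.le
          _ = 2 := Real.rpow_one _
      · exact bot_le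
      · exact bot_le
    refine (lintegral_mono hle).trans (le_of_eq ?_)
    rw [lintegral_add_left ((P1f_meas b).const_mul _), lintegral_const_mul _ (P1f_meas b),
      lintegral_const_mul _ (by fun_prop)]
    congr 2
    exact lintegral_sub_right_eq_self (fun w : ℝ => ENNReal.ofReal (Real.exp (-c * w ^ 2))) η

theorem geom_trunc (Q : ℝ) (hQ : 0 ≤ Q) (n : ℕ) :
    ∑ k ∈ Finset.range n, (if (2:ℝ) ^ k ≤ Q then (2:ℝ) ^ k else 0) ≤ min (2 ^ n) (2 * Q) := by
  induction n with
  | zero => simp [hQ]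
  | succ n ih =>
    rw [Finset.sum_range_succ]
    have h1 := ih.trans (min_le_left _ _)
    have h2 := ih.trans (min_le_right _ _)
    have : (0:ℝ) < 2 ^ n := by positivity
    split_ifs with h
    · refine le_min ?_ ?_ <;> (try rw [pow_succ]) <;> linarith
    · refine le_min ?_ ?_ <;> (try rw [pow_succ]) <;> linarith

noncomputable def kap (Y : ℝ) (k : ℕ) : ENNReal :=
  ENNReal.ofReal ((1 / 2) ^ k) + if (2:ℝ) ^ k ≤ 4 * Y ^ 2 then ENNReal.ofReal (2 ^ k / Y ^ 2) else 0

theorem kap_meas (k : ℕ) : Measurable (fun Y => kap Y k) := by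
  unfold kap
  refine Measurable.const_add ?_ _
  refine Measurable.ite ?_ (by fun_prop) measurable_const
  exact measurableSet_le measurable_const (by fun_prop : Measurable fun Y : ℝ => 4 * Y ^ 2)

theorem kap_sum {Y : ℝ} (hY : 0 < Y) : ∑' k, kap Y k ≤ 10 := by
  unfold kap
  rw [ENNReal.tsum_add]
  have h1 : ∑' k : ℕ, ENNReal.ofReal ((1 / 2) ^ k) = 2 := by
    rw [← ENNReal.ofReal_tsum_of_nonneg (fun n => by positivity) summable_geometric_two,
      tsum_geometric_two]; simp
  have h2 : ∑' k : ℕ, (if (2:ℝ) ^ k ≤ 4 * Y ^ 2 then ENNReal.ofReal (2 ^ k / Y ^ 2) else 0) ≤ 8 := by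
    refine ENNReal.tsum_le_of_sum_range_le fun n => ?_
    have e : ∀ k : ℕ, (if (2:ℝ) ^ k ≤ 4 * Y ^ 2 then ENNReal.ofReal (2 ^ k / Y ^ 2) else 0) =
        ENNReal.ofReal ((if (2:ℝ) ^ k ≤ 4 * Y ^ 2 then (2:ℝ) ^ k else 0) / Y ^ 2) := by
      intro k; split_ifs <;> simp
    simp only [e]
    rw [← ENNReal.ofReal_sum_of_nonneg (fun k _ => by split_ifs <;> positivity), ← Finset.sum_div]
    have := (geom_trunc (4 * Y ^ 2) (by positivity) n).trans (min_le_right _ _)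
    rw [show (8 : ENNReal) = ENNReal.ofReal 8 by simp]
    apply ENNReal.ofReal_le_ofReal
    rw [div_le_iff₀ (by positivity)]
    linarith
  rw [h1]
  calc _ ≤ (2 : ENNReal) + 8 := by gcongr
    _ = 10 := by norm_num


noncomputable def GG {n : ℕ} (b : Fin n → ℝ) (z v : Fin n → ℝ) (Y : ℝ) : ENNReal :=
  ∏ i, P1f (b i) (z i) + ∑' k : ℕ, kap Y k * ∏ i, (ENNReal.ofReal (2 ^ k) *
    G1f (b i) (1 / (64 * (n + 1))) (2 ^ k * (v i / Y)) (2 ^ k * z i))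

theorem GG_meas {n : ℕ} (b : Fin n → ℝ) {Ω : Type*} [MeasurableSpace Ω] {z v : Ω → Fin n → ℝ}
    {Y : Ω → ℝ} (hz : Measurable z) (hv : Measurable v) (hY : Measurable Y) :
    Measurable (fun ω => GG b (z ω) (v ω) (Y ω)) := by
  unfold GG
  have hzi : ∀ i, Measurable fun ω => z ω i := fun i => (measurable_pi_apply i).comp hz
  have hvi : ∀ i, Measurable fun ω => v ω i := fun i => (measurable_pi_apply i).comp hv
  refine Measurable.add ?_ ?_
  · exact Finset.measurable_prod _ fun i _ => (P1f_meas _).comp (hzi i)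
  · refine Measurable.tsum fun k => ?_
    refine ((kap_meas k).comp hY).mul (Finset.measurable_prod _ fun i _ => Measurable.const_mul ?_ _)
    exact (G1f_meas _ _).comp (Measurable.prodMk (((hvi i).div hY).const_mul _) ((hzi i).const_mul _))

theorem GG_int {n : ℕ} (b : Fin n → ℝ) (hb : ∀ i, 0 ≤ b i) (hb1 : ∀ i, b i < 1) :
    ∃ C : ENNReal, C ≠ ⊤ ∧ ∀ v Y, 0 < Y → ∫⁻ z, GG b z v Y ≤ C := by
  have hc : (0:ℝ) < 1 / (64 * (n + 1)) := by positivity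
  choose CG hCG hG using fun i => G1f_int (hb i) (hb1 i) hc
  refine ⟨∏ i, (∫⁻ w, P1f (b i) w) + 10 * ∏ i, CG i, ?_, ?_⟩
  · exact ENNReal.add_ne_top.2 ⟨ENNReal.prod_ne_top fun i _ => P1f_int (hb1 i),
      ENNReal.mul_ne_top (by simp) (ENNReal.prod_ne_top fun i _ => hCG i)⟩
  intro v Y hY
  have hG1m : ∀ (i : Fin n) (k : ℕ), Measurable fun w => G1f (b i) (1 / (64 * (n + 1))) (2 ^ k * (v i / Y)) w :=
    fun i k => (G1f_meas _ _).comp (Measurable.prodMk measurable_const measurable_id)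
  have hm : ∀ (i : Fin n) (k : ℕ), Measurable fun w => ENNReal.ofReal (2 ^ k) *
    G1f (b i) (1 / (64 * (n + 1))) (2 ^ k * (v i / Y)) (2 ^ k * w) := fun i k =>
      ((hG1m i k).comp (measurable_const_mul _)).const_mul _
  have hPm : Measurable fun z : Fin n → ℝ => ∏ i, P1f (b i) (z i) :=
    Finset.measurable_prod _ fun i _ => (P1f_meas _).comp (measurable_pi_apply i)
  have hQm : ∀ k : ℕ, Measurable fun z : Fin n → ℝ => ∏ i, (ENNReal.ofReal (2 ^ k) *
    G1f (b i) (1 / (64 * (n + 1))) (2 ^ k * (v i / Y)) (2 ^ k * z i)) := fun k =>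
    Finset.measurable_prod _ fun i _ => (hm i k).comp (measurable_pi_apply i)
  unfold GG
  rw [lintegral_add_left hPm]
  rw [volume_pi, lint_prod (fun _ => volume) (fun i w => P1f (b i) w) (fun i => P1f_meas _)]
  gcongr
  rw [lintegral_tsum fun k => ((hQm k).const_mul _).aemeasurable]
  calc _ ≤ ∑' k, kap Y k * ∏ i, CG i := by
        refine ENNReal.tsum_le_tsum fun k => ?_
        rw [lintegral_const_mul _ (hQm k)]
        rw [lint_prod (fun _ => volume) (fun i w => ENNReal.ofReal (2 ^ k) *
          G1f (b i) (1 / (64 * (n + 1))) (2 ^ k * (v i / Y)) (2 ^ k * w)) (fun i => hm i k)]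
        gcongr with i
        rw [lint_scale _ (hG1m i k) (by positivity)]
        exact hG i _
    _ = (∑' k, kap Y k) * ∏ i, CG i := ENNReal.tsum_mul_right
    _ ≤ _ := by gcongr; exact kap_sum hY

theorem ptA' (n : ℕ) (b : Fin n → ℝ) (hb : ∀ i, 0 ≤ b i) (hb1 : ∀ i, b i ≤ 1) :
    ∃ C : ENNReal, C ≠ ⊤ ∧ ∀ (ρ σ s Y : ℝ) (z v : Fin n → ℝ), 1 ≤ ρ → 0 < σ → σ ≤ 1 → 1 ≤ σ * ρ ^ 2 →
      s = σ ^ 2 * ρ ^ 2 → s < 1 → 0 < Y → (∀ i, 0 < z i) → (∀ i, z i ≤ 1) →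
      ENNReal.ofReal (AA b ρ σ s Y z v) ≤ C * GG b z v Y := by
  obtain ⟨C, hC, h⟩ := ptA n b hb hb1
  refine ⟨ENNReal.ofReal C, ENNReal.ofReal_ne_top, ?_⟩
  intro ρ σ s Y z v h1 h2 h3 h4 h5 h6 h7 hz hz1
  unfold GG
  rcases h ρ σ s Y z v h1 h2 h3 h4 h5 h6 h7 hz hz1 with h | ⟨k, κ, hκ0, hκ, h⟩
  · refine (ENNReal.ofReal_le_ofReal h).trans ?_
    rw [ENNReal.ofReal_mul hC.le]
    gcongr
    refine le_add_right ?_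
    rw [ENNReal.ofReal_prod_of_nonneg (fun i _ => by have := hz i; positivity)]
    refine Finset.prod_le_prod' fun i _ => ?_
    unfold P1f
    rw [if_pos ⟨hz i, hz1 i⟩]
  · refine (ENNReal.ofReal_le_ofReal h).trans ?_
    rw [ENNReal.ofReal_mul hC.le]
    gcongr
    refine le_add_left ?_
    refine le_trans ?_ (ENNReal.le_tsum k)
    have hb2 : ∀ i, 0 < 1 + 1 / (2 ^ k * z i) := fun i => by have := hz i; positivity
    rw [ENNReal.ofReal_mul hκ0, ENNReal.ofReal_prod_of_nonneg
      (fun i _ => by have := hb2 i; positivity)]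
    refine mul_le_mul' ?_ (Finset.prod_le_prod' fun i _ => ?_)
    · unfold kap
      rcases hκ with rfl | ⟨hk, rfl⟩
      · exact le_add_right le_rfl
      · rw [if_pos hk]; exact le_add_left le_rfl
    · rw [ENNReal.ofReal_mul (by positivity)]
      unfold G1f
      rw [if_pos (by have := hz i; positivity)]


theorem radial (p : ℝ) : ∃ C : ENNReal, C ≠ ⊤ ∧ ∀ (b : ℝ) (c h : ENNReal), 1 ≤ b →
    ∫⁻ ρ in {ρ : ℝ | 1 ≤ ρ ∧ c * ENNReal.ofReal (ρ ^ p * Real.exp (-(b * ρ ^ 2))) ≤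
      h * ENNReal.ofReal ρ}, c * ENNReal.ofReal (ρ ^ p * Real.exp (-(b * ρ ^ 2))) ≤ C * h := by
  obtain ⟨D, hD, hD2⟩ := rpow_exp_bdd |p| (1/2) (abs_nonneg p) (by norm_num)
  refine ⟨ENNReal.ofReal (Real.exp 1 * D), ENNReal.ofReal_ne_top, ?_⟩
  intro b c h hb
  have hCpos : 0 < Real.exp 1 * D := by have := Real.exp_pos 1; nlinarith
  set S := {ρ : ℝ | 1 ≤ ρ ∧ c * ENNReal.ofReal (ρ ^ p * Real.exp (-(b * ρ ^ 2))) ≤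
      h * ENNReal.ofReal ρ} with hS
  by_cases hh : h = ⊤
  · rw [hh, ENNReal.mul_top (by simpa using hCpos)]; exact le_top
  rcases S.eq_empty_or_nonempty with hSe | hSne
  · rw [hSe]; simp
  have hcT : c ≠ ⊤ := by
    rintro rfl
    obtain ⟨ρ, h1, h2⟩ := hSne
    rw [ENNReal.top_mul, top_le_iff] at h2
    · exact ENNReal.mul_ne_top hh ENNReal.ofReal_ne_top h2
    · have : 0 < ρ := by linarith
      simp only [ne_eq, ENNReal.ofReal_eq_zero, not_le]; positivity
  have hcl : IsClosed S := by
    have e : S = {ρ : ℝ | 1 ≤ ρ} ∩ {ρ : ℝ | c * ENNReal.ofReal ((max ρ 1) ^ p * Real.exp (-(b * ρ ^ 2))) ≤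
      h * ENNReal.ofReal ρ} := by
      ext ρ
      simp only [hS, Set.mem_ofPred_eq, Set.mem_inter_iff]
      refine and_congr_right fun h1 => ?_
      rw [max_eq_left h1]
    rw [e]
    refine (isClosed_le continuous_const continuous_id).inter (isClosed_le ?_ ?_)
    · refine (ENNReal.continuous_const_mul hcT).comp (ENNReal.continuous_ofReal.comp ?_)
      refine Continuous.mul ?_ (by fun_prop)
      refine Continuous.rpow_const (by fun_prop) fun x => Or.inl ?_
      have : 1 ≤ max x 1 := le_max_right _ _
      linarith
    · exact (ENNReal.continuous_const_mul hh).comp ENNReal.continuous_ofReal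
  have hbd : BddBelow S := ⟨1, fun x hx => hx.1⟩
  set N := sInf S with hN
  obtain ⟨hN1, hN2⟩ : N ∈ S := hcl.csInf_mem hSne hbd
  have hN0 : 0 < N := by linarith
  have hpt : ∀ ρ, N ≤ ρ → ρ ^ p * Real.exp (-(b * ρ ^ 2)) ≤
      N ^ p * Real.exp (-(b * N ^ 2)) * (Real.exp 1 * D) * (Real.exp (2 * N * N) * Real.exp (-(2 * N) * ρ)) := by
    intro ρ hρ
    have hρ0 : 0 < ρ := by linarith
    obtain ⟨t, ht⟩ : ∃ t, t = ρ - N := ⟨_, rfl⟩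
    have ht0 : 0 ≤ t := by linarith
    have e1 : ρ ^ p ≤ N ^ p * (1 + t) ^ |p| := by
      have : ρ = N * (ρ / N) := by field_simp
      have hr : 1 ≤ ρ / N := by rw [le_div_iff₀ hN0]; linarith
      have hr2 : ρ / N ≤ 1 + t := by rw [div_le_iff₀ hN0]; nlinarith
      calc ρ ^ p = N ^ p * (ρ / N) ^ p := by
            rw [← Real.mul_rpow hN0.le (by positivity)]; congr 1
        _ ≤ N ^ p * (ρ / N) ^ |p| := by
            gcongr
            exact le_abs_self p
        _ ≤ _ := by gcongr
    have e2 : (1 + t) ^ |p| ≤ D * Real.exp (1/2 * (1+t)^2) := by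
      have := hD2 (1 + t) (by linarith)
      have e := Real.exp_pos (1/2 * (1+t)^2)
      calc (1 + t) ^ |p| = ((1 + t) ^ |p| * Real.exp (-(1/2) * (1+t)^2)) * Real.exp (1/2 * (1+t)^2) := by
            rw [mul_assoc, ← Real.exp_add]; ring_nf; simp
        _ ≤ _ := by gcongr
    calc ρ ^ p * Real.exp (-(b * ρ ^ 2)) ≤ (N ^ p * (D * Real.exp (1/2 * (1+t)^2))) * Real.exp (-(b * ρ ^ 2)) := by
          gcongr; exact e1.trans (by gcongr)
      _ = N ^ p * D * (Real.exp (1/2 * (1+t)^2) * Real.exp (-(b * ρ ^ 2))) := by ring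
      _ ≤ N ^ p * D * (Real.exp (-(b * N ^ 2)) * Real.exp 1 * (Real.exp (2 * N * N) * Real.exp (-(2 * N) * ρ))) := by
          have hD0 : 0 ≤ D := by linarith
          refine mul_le_mul_of_nonneg_left ?_ (by positivity)
          simp only [← Real.exp_add]
          apply Real.exp_le_exp.2
          have : ρ = N + t := by linarith
          subst this
          nlinarith [sq_nonneg (1 - t), mul_nonneg hN0.le ht0, mul_nonneg (sub_nonneg.2 hb) (mul_nonneg hN0.le ht0), mul_nonneg (sub_nonneg.2 hb) (sq_nonneg t)]
      _ = _ := by ring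
  have hint : ∫⁻ ρ in Set.Ioi N, ENNReal.ofReal (Real.exp (-(2 * N) * ρ)) =
      ENNReal.ofReal (Real.exp (-(2 * N) * N) / (2 * N)) := by
    rw [← ofReal_integral_eq_lintegral_ofReal (integrableOn_exp_mul_Ioi (by linarith) N)
      (Filter.Eventually.of_forall fun x => (Real.exp_pos _).le), integral_exp_mul_Ioi (by linarith) N]
    congr 1
    rw [neg_div, div_neg, neg_neg]
  have hsub : S ⊆ Set.Ici N := fun x hx => csInf_le hbd hx
  set K := N ^ p * Real.exp (-(b * N ^ 2)) with hK
  have hK0 : 0 ≤ K := by positivity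
  calc _ ≤ ∫⁻ ρ in Set.Ici N, c * ENNReal.ofReal (ρ ^ p * Real.exp (-(b * ρ ^ 2))) :=
        lintegral_mono_set hsub
    _ ≤ ∫⁻ ρ in Set.Ici N, c * ENNReal.ofReal (K * (Real.exp 1 * D) * Real.exp (2 * N * N)) * ENNReal.ofReal (Real.exp (-(2 * N) * ρ)) := by
        refine setLIntegral_mono (by fun_prop) fun ρ hρ => ?_
        rw [mul_assoc, ← ENNReal.ofReal_mul (by positivity)]
        refine mul_le_mul' le_rfl (ENNReal.ofReal_le_ofReal ?_)
        exact (hpt ρ hρ).trans (le_of_eq (by ring))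
    _ = c * ENNReal.ofReal (K * (Real.exp 1 * D) * Real.exp (2 * N * N)) * ENNReal.ofReal (Real.exp (-(2 * N) * N) / (2 * N)) := by
        rw [lintegral_const_mul _ (by fun_prop), setLIntegral_congr Ioi_ae_eq_Ici.symm, hint]
    _ = c * ENNReal.ofReal K * ENNReal.ofReal (Real.exp 1 * D / (2 * N)) := by
        rw [mul_assoc, mul_assoc c (ENNReal.ofReal K), ← ENNReal.ofReal_mul (by positivity), ← ENNReal.ofReal_mul hK0]
        congr 2
        have : Real.exp (2 * N * N) * Real.exp (-(2 * N) * N) = 1 := by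
          rw [← Real.exp_add]; ring_nf; simp
        calc _ = K * (Real.exp 1 * D) / (2 * N) * (Real.exp (2 * N * N) * Real.exp (-(2 * N) * N)) := by ring
          _ = _ := by rw [this]; ring
    _ ≤ h * ENNReal.ofReal N * ENNReal.ofReal (Real.exp 1 * D / (2 * N)) := by gcongr
    _ ≤ _ := by
        rw [mul_assoc, mul_comm, ← ENNReal.ofReal_mul hN0.le]
        refine mul_le_mul' (ENNReal.ofReal_le_ofReal ?_) le_rfl
        rw [show N * (Real.exp 1 * D / (2 * N)) = Real.exp 1 * D / 2 by field_simp]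
        linarith


def ins {n : ℕ} (j : Fin (n + 1)) (ρ : ℝ) (v : Fin n → ℝ) : Fin (n + 1) → ℝ :=
  Fin.insertNth (α := fun _ => ℝ) j ρ v

theorem ins_same {n : ℕ} (j : Fin (n + 1)) (ρ : ℝ) (v : Fin n → ℝ) : ins j ρ v j = ρ := by
  simp [ins]
theorem ins_succ {n : ℕ} (j : Fin (n + 1)) (ρ : ℝ) (v : Fin n → ℝ) (i : Fin n) :
    ins j ρ v (j.succAbove i) = v i := by
  simp [ins]

theorem ins_meas {n : ℕ} (j : Fin (n + 1)) {Ω : Type*} [MeasurableSpace Ω] {ρ : Ω → ℝ}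
    {v : Ω → Fin n → ℝ} (hρ : Measurable ρ) (hv : Measurable v) :
    Measurable fun ω => ins j (ρ ω) (v ω) := by
  rw [measurable_pi_iff, j.forall_iff_succAbove]
  refine ⟨by simpa [ins_same] using hρ, fun i => ?_⟩
  simp only [ins_succ]
  exact (measurable_pi_apply i).comp hv

theorem lint_ins {n : ℕ} (j : Fin (n + 1)) (F : (Fin (n + 1) → ℝ) → ENNReal) (hF : Measurable F) :
    ∫⁻ x, F x = ∫⁻ ρ, ∫⁻ v, F (ins j ρ v) := by
  have h := (volume_preserving_piFinSuccAbove (fun _ => ℝ) j).symm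
  rw [← h.lintegral_comp hF, Measure.volume_eq_prod, lintegral_prod]
  · rfl
  · exact (hF.comp (MeasurableEquiv.measurable _)).aemeasurable

theorem lint_scale_n {n : ℕ} (f : (Fin n → ℝ) → ENNReal) (hf : Measurable f) {c : ℝ} (hc : 0 < c) :
    ∫⁻ x, f x = ∫⁻ x : Fin n → ℝ, ENNReal.ofReal (c ^ n) * f (fun i => c * x i) := by
  have h := Measure.map_addHaar_smul (volume : Measure (Fin n → ℝ)) hc.ne'
  have e : ∫⁻ x : Fin n → ℝ, f (fun i => c * x i) = ∫⁻ x, f x ∂(Measure.map (c • ·) volume) := by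
    rw [lintegral_map hf (measurable_const_smul c)]; rfl
  rw [lintegral_const_mul, e, h, lintegral_smul_measure, smul_eq_mul, ← mul_assoc,
    ← ENNReal.ofReal_mul (by positivity), Module.finrank_fin_fun, abs_of_pos (by positivity),
    mul_inv_cancel₀ (by positivity), ENNReal.ofReal_one, one_mul]
  exact hf.comp (by fun_prop : Measurable fun (x : Fin n → ℝ) (i : Fin n) => c * x i)

noncomputable def dens {d : ℕ} (a : Fin d → ℝ) (x : Fin d → ℝ) : ℝ :=
  (∏ i, x i ^ (a i)) * Real.exp (-∑ i, x i ^ 2)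

theorem dens_meas {d : ℕ} (a : Fin d → ℝ) : Measurable (dens a) := by
  unfold dens; fun_prop

theorem dens_ins {n : ℕ} (a : Fin (n + 1) → ℝ) (j : Fin (n + 1)) {ρ : ℝ} (hρ : 0 < ρ)
    (z : Fin n → ℝ) (hz : ∀ i, 0 < z i) :
    ρ ^ n * dens a (ins j ρ (fun i => ρ * z i)) = (∏ i, z i ^ (a (j.succAbove i))) *
      (ρ ^ (∑ i, a i + n) * Real.exp (-((1 + ∑ i, z i ^ 2) * ρ ^ 2))) := by
  unfold dens
  rw [Fin.prod_univ_succAbove _ j, Fin.sum_univ_succAbove _ j, Fin.sum_univ_succAbove _ j]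
  simp only [ins_same, ins_succ]
  have e : ∏ i, (ρ * z i) ^ a (j.succAbove i) = ρ ^ (∑ i, a (j.succAbove i)) * ∏ i, z i ^ a (j.succAbove i) := by
    rw [Real.rpow_sum_of_pos hρ, ← Finset.prod_mul_distrib]
    exact Finset.prod_congr rfl fun i _ => Real.mul_rpow hρ.le (hz i).le
  rw [e, Real.rpow_add hρ, Real.rpow_add hρ, Real.rpow_natCast]
  have e2 : -(ρ ^ 2 + ∑ i, (ρ * z i) ^ 2) = -((1 + ∑ i, z i ^ 2) * ρ ^ 2) := by
    simp only [mul_pow, ← Finset.mul_sum]; ring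
  rw [e2]; ring

theorem polar {n : ℕ} (a : Fin (n + 1) → ℝ) (j : Fin (n + 1)) : ∃ C : ENNReal, C ≠ ⊤ ∧
    ∀ (H : (Fin n → ℝ) → ENNReal) (lam : ENNReal), Measurable H →
    lam * Measure.pi (fun i => nu1 (a i)) {x | (∀ i, 0 < x i) ∧ 1 ≤ x j ∧
      lam * ENNReal.ofReal (x j ^ n * dens a x) ≤
        H (fun i => x (j.succAbove i) / x j) * ENNReal.ofReal (x j)} ≤ C * ∫⁻ z, H z := by
  obtain ⟨C, hC, hrad⟩ := radial (∑ i, a i + n)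
  refine ⟨C, hC, fun H lam hH => ?_⟩
  set E := {x : Fin (n + 1) → ℝ | (∀ i, 0 < x i) ∧ 1 ≤ x j ∧
      lam * ENNReal.ofReal (x j ^ n * dens a x) ≤
        H (fun i => x (j.succAbove i) / x j) * ENNReal.ofReal (x j)} with hE
  have hpos : MeasurableSet {x : Fin (n + 1) → ℝ | ∀ i, 0 < x i} := by
    rw [Set.ofPred_forall]
    exact MeasurableSet.iInter fun i => measurableSet_lt measurable_const (measurable_pi_apply i)
  have hEm : MeasurableSet E := by
    have hs2 : MeasurableSet {x : Fin (n + 1) → ℝ | 1 ≤ x j} :=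
      measurableSet_le measurable_const (measurable_pi_apply j)
    suffices hs : MeasurableSet {x : Fin (n + 1) → ℝ | lam * ENNReal.ofReal (x j ^ n * dens a x) ≤
        H (fun i => x (j.succAbove i) / x j) * ENNReal.ofReal (x j)} from hpos.inter (hs2.inter hs)
    refine measurableSet_le ?_ ?_
    · have := dens_meas a
      exact (ENNReal.measurable_ofReal.comp (((measurable_pi_apply j).pow_const n).mul this)).const_mul _
    · refine Measurable.mul (hH.comp (measurable_pi_iff.2 fun i =>
        (measurable_pi_apply _).div (measurable_pi_apply _))) ?_
      exact ENNReal.measurable_ofReal.comp (measurable_pi_apply j)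
  have hmeq : Measure.pi (fun i => nu1 (a i)) E = ∫⁻ x, E.indicator (fun x => ENNReal.ofReal (dens a x)) x := by
    have h := nu_eq (n + 1) (fun i => (a i - 1) / 2)
    have e : ∀ i, 2 * ((a i - 1) / 2) + 1 = a i := fun i => by ring
    simp only [e] at h
    rw [← h, Measure.restrict_apply hEm, withDensity_apply _ (hEm.inter hpos), lintegral_indicator hEm,
      Set.inter_eq_left.2 (fun x hx => hx.1)]
    rfl
  have hdm : Measurable fun x => ENNReal.ofReal (dens a x) := ENNReal.measurable_ofReal.comp (dens_meas a)
  rw [hmeq, ← lintegral_const_mul _ (hdm.indicator hEm)]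
  set F := fun x => lam * E.indicator (fun x => ENNReal.ofReal (dens a x)) x with hF
  have hFm : Measurable F := (hdm.indicator hEm).const_mul _
  change ∫⁻ x, F x ≤ _
  rw [lint_ins j F hFm]
  calc ∫⁻ ρ, ∫⁻ v, F (ins j ρ v) ≤ ∫⁻ ρ, ∫⁻ z : Fin n → ℝ, ENNReal.ofReal (ρ ^ n) * F (ins j ρ (fun i => ρ * z i)) := by
        refine lintegral_mono fun ρ => ?_
        by_cases hρ : 0 < ρ
        · rw [lint_scale_n (fun v => F (ins j ρ v)) (hFm.comp (ins_meas j measurable_const measurable_id)) hρ]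
        · have : ∀ v, F (ins j ρ v) = 0 := by
            intro v
            simp only [hF]
            rw [Set.indicator_of_notMem, mul_zero]
            rintro ⟨h1, -⟩
            have := h1 j
            rw [ins_same] at this
            exact hρ this
          simp [this]
    _ = ∫⁻ z : Fin n → ℝ, ∫⁻ ρ, ENNReal.ofReal (ρ ^ n) * F (ins j ρ (fun i => ρ * z i)) := by
        apply lintegral_lintegral_swap
        refine Measurable.aemeasurable ?_
        refine Measurable.mul (by fun_prop) (hFm.comp (ins_meas j measurable_fst ?_))
        exact measurable_pi_iff.2 fun i => measurable_fst.mul ((measurable_pi_apply i).comp measurable_snd)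
    _ ≤ ∫⁻ z, C * H z := by
        refine lintegral_mono fun z => ?_
        by_cases hz : ∀ i, 0 < z i
        · have hb : 1 ≤ 1 + ∑ i, z i ^ 2 := by
            have := Finset.sum_nonneg fun i (_ : i ∈ Finset.univ) => sq_nonneg (z i); linarith
          set c : ENNReal := lam * ENNReal.ofReal (∏ i, z i ^ (a (j.succAbove i))) with hc
          have hPn : 0 ≤ ∏ i, z i ^ (a (j.succAbove i)) := Finset.prod_nonneg fun i _ => by
            have := hz i; positivity
          have key : ∀ ρ, 0 < ρ → lam * ENNReal.ofReal (ρ ^ n * dens a (ins j ρ (fun i => ρ * z i))) =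
              c * ENNReal.ofReal (ρ ^ (∑ i, a i + n) * Real.exp (-((1 + ∑ i, z i ^ 2) * ρ ^ 2))) := by
            intro ρ hρ
            rw [dens_ins a j hρ z hz, ENNReal.ofReal_mul hPn, mul_assoc]
          refine le_trans ?_ (hrad _ c (H z) hb)
          rw [← lintegral_indicator]
          · refine lintegral_mono fun ρ => ?_
            by_cases hm : ins j ρ (fun i => ρ * z i) ∈ E
            · have hρ1 := hm.2.1
              have hm3 := hm.2.2
              rw [ins_same] at hρ1 hm3
              have hρ0 : 0 < ρ := by linarith
              have e : (fun i => ins j ρ (fun i => ρ * z i) (j.succAbove i) / ρ) = z := by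
                funext i; rw [ins_succ]; field_simp
              rw [key ρ hρ0, e] at hm3
              rw [Set.indicator_of_mem]
              · rw [← key ρ hρ0]
                simp only [hF]
                rw [Set.indicator_of_mem hm, ENNReal.ofReal_mul (by positivity)]
                apply le_of_eq; ring
              · exact ⟨hρ1, hm3⟩
            · simp only [hF]
              rw [Set.indicator_of_notMem hm]; simp
          · have hs2 : MeasurableSet {ρ : ℝ | 1 ≤ ρ} := measurableSet_le measurable_const measurable_id
            suffices hs : MeasurableSet {ρ : ℝ | c * ENNReal.ofReal (ρ ^ (∑ i, a i + n) *
              Real.exp (-((1 + ∑ i, z i ^ 2) * ρ ^ 2))) ≤ H z * ENNReal.ofReal ρ} from hs2.inter hs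
            refine measurableSet_le ?_ ?_
            · exact Measurable.const_mul (by fun_prop) _
            · exact Measurable.const_mul (by fun_prop) _
        · have : ∀ ρ, ENNReal.ofReal (ρ ^ n) * F (ins j ρ (fun i => ρ * z i)) = 0 := by
            intro ρ
            simp only [hF]
            rw [Set.indicator_of_notMem, mul_zero, mul_zero]
            rintro ⟨h1, -⟩
            apply hz
            intro i
            have h2 := h1 j
            have h3 := h1 (j.succAbove i)
            rw [ins_same] at h2
            rw [ins_succ] at h3
            exact (mul_pos_iff_of_pos_left h2).1 h3
          simp [this]
    _ = C * ∫⁻ z, H z := lintegral_const_mul _ hH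


theorem UU_pos (b : ℝ) {s x : ℝ} (y : ℝ) (hs : 0 < s) (hx : 0 < x) : 0 < UU b s x y := by
  unfold UU
  have := Real.sqrt_pos.2 hs
  positivity

theorem UU_one {b s x ρ y : ℝ} (hs : 0 < s) (hs1 : s < 1) (hx : 0 < x) (hρ : 0 < ρ) :
    UU b s x y ≤ ρ⁻¹ * (√s / ρ)⁻¹ * (1 + (√s / ρ) / (x / ρ)) ^ b *
      Real.exp (-(x / ρ - (1 - s) / (1 + s) * y / ρ) ^ 2 / (16 * (√s / ρ) ^ 2)) := by
  have hr := Real.sqrt_pos.2 hs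
  unfold UU
  have e1 : ρ⁻¹ * (√s / ρ)⁻¹ = (√s)⁻¹ := by field_simp
  have e2 : (√s / ρ) / (x / ρ) = √s / x := by field_simp
  rw [e1, e2]
  gcongr
  rw [neg_div]
  apply neg_le_neg
  unfold qq
  have e3 : (x / ρ - (1 - s) / (1 + s) * y / ρ) ^ 2 / (16 * (√s / ρ) ^ 2) =
      (x - (1 - s) / (1 + s) * y) ^ 2 / (16 * s) := by
    rw [div_pow, Real.sq_sqrt hs.le]; field_simp
  have e4 : ((1 + s) * x - (1 - s) * y) ^ 2 = (1 + s) ^ 2 * (x - (1 - s) / (1 + s) * y) ^ 2 := by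
    field_simp
  rw [e3, e4, div_div, show 8 * s * 2 = 16 * s by ring]
  gcongr
  nlinarith [sq_nonneg (x - (1 - s) / (1 + s) * y), mul_nonneg hs.le (sq_nonneg (x - (1 - s) / (1 + s) * y)), mul_nonneg (sq_nonneg s) (sq_nonneg (x - (1 - s) / (1 + s) * y))]

theorem UU_AA {n : ℕ} (b : Fin (n + 1) → ℝ) (hb : ∀ i, 0 ≤ b i) (hb1 : ∀ i, b i < 1) (j : Fin (n + 1))
    {s : ℝ} {x y : Fin (n + 1) → ℝ} (hs : 0 < s) (hs1 : s < 1) (hx : ∀ i, 0 < x i) (hρ : 1 ≤ x j) :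
    x j ^ n * ∏ i, UU (b i) s (x i) (y i) ≤ 2 * (AA (fun i => b (j.succAbove i)) (x j) (√s / x j) s (y j)
      (fun i => x (j.succAbove i) / x j) (fun i => y (j.succAbove i)) * x j) := by
  have hr := Real.sqrt_pos.2 hs
  set ρ := x j with hρd
  have hρ0 : 0 < ρ := by linarith
  set σ := √s / ρ with hσ
  have hσ0 : 0 < σ := by positivity
  have hσ1 : σ ≤ 1 := by
    rw [hσ, div_le_one hρ0]
    exact (Real.sqrt_le_one.2 hs1.le).trans hρ
  have h1 : UU (b j) s ρ (y j) ≤ ρ⁻¹ * σ⁻¹ * 2 *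
      Real.exp (-(1 - (1 - s) / (1 + s) * y j / ρ) ^ 2 / (16 * σ ^ 2)) := by
    refine (UU_one hs hs1 hρ0 hρ0).trans ?_
    rw [div_self hρ0.ne', div_one]
    gcongr
    calc (1 + σ) ^ b j ≤ (2 : ℝ) ^ b j := Real.rpow_le_rpow (by positivity) (by linarith) (hb j)
      _ ≤ 2 ^ (1 : ℝ) := Real.rpow_le_rpow_of_exponent_le (by norm_num) (hb1 j).le
      _ = 2 := Real.rpow_one _
  rw [Fin.prod_univ_succAbove _ j]
  have h2 : ∏ i, UU (b (j.succAbove i)) s (x (j.succAbove i)) (y (j.succAbove i)) ≤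
      ∏ i : Fin n, (ρ⁻¹ * σ⁻¹ * (1 + σ / (x (j.succAbove i) / ρ)) ^ b (j.succAbove i) *
      Real.exp (-(x (j.succAbove i) / ρ - (1 - s) / (1 + s) * y (j.succAbove i) / ρ) ^ 2 / (16 * σ ^ 2))) :=
    Finset.prod_le_prod (fun i _ => (UU_pos _ _ hs (hx _)).le) fun i _ => UU_one hs hs1 (hx _) hρ0
  rw [Finset.prod_mul_distrib, Finset.prod_mul_distrib, Finset.prod_const, Finset.card_univ,
    Fintype.card_fin, ← Real.exp_sum] at h2
  calc _ ≤ ρ ^ n * (_ * _) := by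
        refine mul_le_mul_of_nonneg_left (mul_le_mul h1 h2
          (Finset.prod_nonneg fun i _ => (UU_pos _ _ hs (hx _)).le) (by positivity)) (by positivity)
    _ = 2 * (AA (fun i => b (j.succAbove i)) ρ σ s (y j)
      (fun i => x (j.succAbove i) / ρ) (fun i => y (j.succAbove i)) * ρ) := by
        unfold AA
        rw [show (-((1 - (1 - s) / (1 + s) * y j / ρ) ^ 2 +
          ∑ i, (x (j.succAbove i) / ρ - (1 - s) / (1 + s) * y (j.succAbove i) / ρ) ^ 2) / (16 * σ ^ 2)) =
          (-(1 - (1 - s) / (1 + s) * y j / ρ) ^ 2 / (16 * σ ^ 2)) +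
          ∑ i, -(x (j.succAbove i) / ρ - (1 - s) / (1 + s) * y (j.succAbove i) / ρ) ^ 2 / (16 * σ ^ 2) by
            rw [← Finset.sum_div, Finset.sum_neg_distrib]; ring, Real.exp_add]
        have e5 : ρ ^ n * (ρ⁻¹ * (ρ⁻¹ * σ⁻¹) ^ n) = (ρ ^ 2)⁻¹ * ρ * (σ⁻¹) ^ n := by
          rw [mul_pow, inv_pow]; field_simp
        generalize Real.exp (-(1 - (1 - s) / (1 + s) * y j / ρ) ^ 2 / (16 * σ ^ 2)) = E1
        generalize Real.exp (∑ i, -(x (j.succAbove i) / ρ - (1 - s) / (1 + s) * y (j.succAbove i) / ρ) ^ 2 / (16 * σ ^ 2)) = E2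
        generalize ∏ i, (1 + σ / (x (j.succAbove i) / ρ)) ^ b (j.succAbove i) = Q
        calc _ = (ρ ^ n * (ρ⁻¹ * (ρ⁻¹ * σ⁻¹) ^ n)) * (σ⁻¹ * 2 * E1 * Q * E2) := by ring
          _ = _ := by rw [e5, pow_succ]; ring

theorem regA {n : ℕ} (a : Fin (n + 1) → ℝ) (k : Fin (n + 1) → ℝ → ℝ → ℝ → ℝ) (b Cu : Fin (n + 1) → ℝ)
    (hb : ∀ i, 0 ≤ b i) (hb1 : ∀ i, b i < 1) (hCu : ∀ i, 1 ≤ Cu i)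
    (hk0 : ∀ i s x y, 0 < s → s < 1 → 0 < x → 0 < y → 0 ≤ k i s x y)
    (hk : ∀ i s x y, 0 < s → s < 1 → 0 < x → 0 < y → k i s x y * w1 (a i) x ≤ Cu i * UU (b i) s x y)
    (j : Fin (n + 1)) :
    ∃ C : ENNReal, C ≠ ⊤ ∧ ∀ (μ : Measure (Fin (n + 1) → ℝ)) [IsFiniteMeasure μ],
      (∀ᵐ y ∂μ, ∀ i, 0 < y i) → ∀ lam : ENNReal,
      lam * Measure.pi (fun i => nu1 (a i)) {x | (∀ i, 0 < x i) ∧ (∀ i, x i ≤ x j) ∧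
        ∃ s, 0 < s ∧ s < 1 ∧ 1 < s * x j ^ 2 ∧
        lam < ∫⁻ y, ∏ i, ENNReal.ofReal (k i s (x i) (y i)) ∂μ} ≤ C * μ Set.univ := by
  obtain ⟨C1, hC1, hpol⟩ := polar a j
  obtain ⟨C2, hC2, hpt⟩ := ptA' n (fun i => b (j.succAbove i)) (fun i => hb _) (fun i => (hb1 _).le)
  obtain ⟨C3, hC3, hGi⟩ := GG_int (fun i => b (j.succAbove i)) (fun i => hb _) (fun i => hb1 _)
  set P : ℝ := ∏ i, Cu i with hP
  have hP0 : 0 ≤ P := Finset.prod_nonneg fun i _ => by linarith [hCu i]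
  refine ⟨C1 * (ENNReal.ofReal (2 * P) * C2 * C3), by finiteness, ?_⟩
  intro μ _ hμ lam
  set A : ENNReal := ENNReal.ofReal (2 * P) * C2 with hA
  have hGm : Measurable fun p : (Fin n → ℝ) × (Fin (n + 1) → ℝ) =>
      GG (fun i => b (j.succAbove i)) p.1 (fun i => p.2 (j.succAbove i)) (p.2 j) := by
    refine GG_meas _ measurable_fst ?_ ((measurable_pi_apply j).comp measurable_snd)
    exact measurable_pi_iff.2 fun i => (measurable_pi_apply _).comp measurable_snd
  set H : (Fin n → ℝ) → ENNReal := fun z => A * ∫⁻ y, GG (fun i => b (j.succAbove i)) z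
    (fun i => y (j.succAbove i)) (y j) ∂μ with hH
  have hHm0 : Measurable fun z : Fin n → ℝ => ∫⁻ y, GG (fun i => b (j.succAbove i)) z
    (fun i => y (j.succAbove i)) (y j) ∂μ := hGm.lintegral_prod_right'
  have hHm : Measurable H := hHm0.const_mul _
  have hHint : ∫⁻ z, H z ≤ A * (C3 * μ Set.univ) := by
    simp only [hH]
    rw [lintegral_const_mul _ hHm0, lintegral_lintegral_swap hGm.aemeasurable]
    gcongr
    rw [← lintegral_const]
    refine lintegral_mono_ae ?_
    filter_upwards [hμ] with y hy
    exact hGi _ _ (hy j)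
  calc _ ≤ lam * Measure.pi (fun i => nu1 (a i)) {x | (∀ i, 0 < x i) ∧ 1 ≤ x j ∧
      lam * ENNReal.ofReal (x j ^ n * dens a x) ≤
        H (fun i => x (j.succAbove i) / x j) * ENNReal.ofReal (x j)} := by
        refine mul_le_mul' le_rfl (measure_mono ?_)
        rintro x ⟨hx, hxj, s, hs, hs1, hsx, hl⟩
        have hρ0 := hx j
        have hρ : 1 ≤ x j := by nlinarith
        have hr := Real.sqrt_pos.2 hs
        refine ⟨hx, hρ, ?_⟩
        have hdens : 0 ≤ x j ^ n * dens a x := by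
          unfold dens
          have : 0 ≤ ∏ i, x i ^ a i := Finset.prod_nonneg fun i _ => by have := hx i; positivity
          positivity
        calc _ ≤ (∫⁻ y, ∏ i, ENNReal.ofReal (k i s (x i) (y i)) ∂μ) * ENNReal.ofReal (x j ^ n * dens a x) := by
              gcongr
          _ = ∫⁻ y, (∏ i, ENNReal.ofReal (k i s (x i) (y i))) * ENNReal.ofReal (x j ^ n * dens a x) ∂μ := by
              rw [lintegral_mul_const' _ _ ENNReal.ofReal_ne_top]
          _ ≤ ∫⁻ y, (A * ENNReal.ofReal (x j)) * GG (fun i => b (j.succAbove i)) (fun i => x (j.succAbove i) / x j)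
                (fun i => y (j.succAbove i)) (y j) ∂μ := by
              refine lintegral_mono_ae ?_
              filter_upwards [hμ] with y hy
              rw [← ENNReal.ofReal_prod_of_nonneg (fun i _ => hk0 i s _ _ hs hs1 (hx i) (hy i)),
                ← ENNReal.ofReal_mul (Finset.prod_nonneg fun i _ => hk0 i s _ _ hs hs1 (hx i) (hy i))]
              have q1 : (∏ i, k i s (x i) (y i)) * (x j ^ n * dens a x) ≤
                  (2 * P) * (x j * AA (fun i => b (j.succAbove i)) (x j) (√s / x j) s (y j)
                  (fun i => x (j.succAbove i) / x j) (fun i => y (j.succAbove i))) := by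
                have e1 : dens a x = ∏ i, w1 (a i) (x i) := by
                  unfold dens w1
                  rw [Finset.prod_mul_distrib, ← Real.exp_sum, Finset.sum_neg_distrib]
                calc _ = x j ^ n * ∏ i, (k i s (x i) (y i) * w1 (a i) (x i)) := by
                      rw [e1, Finset.prod_mul_distrib]; ring
                  _ ≤ x j ^ n * ∏ i, (Cu i * UU (b i) s (x i) (y i)) := by
                      refine mul_le_mul_of_nonneg_left (Finset.prod_le_prod (fun i _ => ?_)
                        fun i _ => hk i s _ _ hs hs1 (hx i) (hy i)) (by positivity)
                      exact mul_nonneg (hk0 i s _ _ hs hs1 (hx i) (hy i)) (w1_pos _ (hx i)).le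
                  _ = P * (x j ^ n * ∏ i, UU (b i) s (x i) (y i)) := by
                      rw [Finset.prod_mul_distrib]; ring
                  _ ≤ P * _ := mul_le_mul_of_nonneg_left (UU_AA b hb hb1 j hs hs1 hx hρ) hP0
                  _ = _ := by ring
              refine (ENNReal.ofReal_le_ofReal q1).trans ?_
              rw [ENNReal.ofReal_mul (by positivity), ENNReal.ofReal_mul hρ0.le]
              have q2 := hpt (x j) (√s / x j) s (y j) (fun i => x (j.succAbove i) / x j)
                (fun i => y (j.succAbove i)) hρ (by positivity) (by
                  rw [div_le_one hρ0]; exact (Real.sqrt_le_one.2 hs1.le).trans hρ) (by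
                  rw [show √s / x j * x j ^ 2 = √s * x j by field_simp]
                  rw [← Real.sqrt_sq hρ0.le, ← Real.sqrt_mul hs.le]
                  exact Real.one_le_sqrt.2 hsx.le) (by
                  rw [div_pow, Real.sq_sqrt hs.le]; field_simp) hs1 (hy j)
                  (fun i => div_pos (hx _) hρ0) (fun i => (div_le_one hρ0).2 (hxj _))
              calc _ ≤ ENNReal.ofReal (2 * P) * (ENNReal.ofReal (x j) * (C2 * _)) :=
                    mul_le_mul' le_rfl (mul_le_mul' le_rfl q2)
                _ = _ := by rw [hA]; ring
          _ = _ := by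
              rw [lintegral_const_mul]
              · simp only [hH]; ring
              · exact hGm.comp (measurable_const.prodMk measurable_id)
    _ ≤ C1 * ∫⁻ z, H z := hpol H lam hHm
    _ ≤ C1 * (A * (C3 * μ Set.univ)) := by gcongr
    _ = _ := by ring


theorem prod_split {d e : ℕ} (hed : e ≤ d) (g : Fin d → ℝ) :
    ∏ i, g i = (∏ i : Fin e, g (Fin.castLE hed i)) *
      ∏ i : Fin (d - e), g ⟨e + (i : ℕ), by have h := i.isLt; omega⟩ := by
  obtain ⟨m, rfl⟩ := Nat.exists_eq_add_of_le hed
  rw [Fin.prod_univ_add]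
  congr 1
  exact Fintype.prod_equiv (finCongr (by omega)) _ _ fun i => rfl

theorem Kker_eq (d : ℕ) (α : Fin d → ℝ) {s : ℝ} (hs : 0 < s) (x y : Fin d → ℝ) :
    Kker d α s x y = ∏ i, kg (2 * α i + 1) s (x i) (y i) := by
  unfold Kker kg
  rw [Finset.prod_mul_distrib, Finset.prod_mul_distrib, Finset.prod_const, Finset.card_univ,
    Fintype.card_fin, ← Real.exp_sum, Finset.sum_sub_distrib]
  unfold qq
  rw [← Finset.sum_div]
  congr 2
  rw [Real.sqrt_eq_rpow, ← Real.rpow_neg hs.le, ← Real.rpow_natCast, ← Real.rpow_mul hs.le]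
  congr 1; ring

noncomputable def kk {d : ℕ} (e : ℕ) (α : Fin d → ℝ) (i : Fin d) (s x y : ℝ) : ℝ :=
  if (i : ℕ) < e then kb (-α i) s x y else kg (2 * α i + 1) s x y

theorem kg_nonneg (a : ℝ) {s x : ℝ} (y : ℝ) (hs : 0 < s) (hx : 0 < x) : 0 ≤ kg a s x y := by
  unfold kg; have := Real.sqrt_pos.2 hs; positivity

theorem kk_nonneg {d : ℕ} (e : ℕ) (α : Fin d → ℝ) (i : Fin d) {s x y : ℝ} (hs : 0 < s) (hs1 : s < 1)
    (hx : 0 < x) (hy : 0 < y) : 0 ≤ kk e α i s x y := by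
  unfold kk
  split_ifs
  · unfold kb
    have := kg_nonneg (2 * -α i + 1) y hs hx
    have h1 : 0 < 1 - s := by linarith
    positivity
  · exact kg_nonneg _ y hs hx

theorem kk_meas {d : ℕ} (e : ℕ) (α : Fin d → ℝ) (i : Fin d) (s x : ℝ) : Measurable (kk e α i s x) := by
  unfold kk
  split_ifs
  · unfold kb kg qq; fun_prop
  · unfold kg qq; fun_prop

theorem KK_eq (d e : ℕ) (hed : e ≤ d) (α : Fin d → ℝ) {s : ℝ} (hs : 0 < s) (hs1 : s < 1) (x y : Fin d → ℝ) :
    KK d e hed α s x y = ∏ i, kk e α i s (x i) (y i) := by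
  unfold KK
  rw [Kker_eq _ _ hs, Kker_eq _ _ hs, prod_split hed (fun i => kk e α i s (x i) (y i))]
  congr 1
  · rw [Finset.mul_sum, Real.rpow_sum_of_pos (by linarith), ← Finset.prod_mul_distrib, ← Finset.prod_mul_distrib]
    refine Finset.prod_congr rfl fun i _ => ?_
    unfold kk kb
    rw [if_pos (by simp)]
    rw [show -2 * α (Fin.castLE hed i) = 2 * -α (Fin.castLE hed i) by ring]
  · refine Finset.prod_congr rfl fun i _ => ?_
    unfold kk
    rw [if_neg (by simp)]

/-- For `d ≥ 1` and `α ∈ (−∞,−1]^e × (−1,∞)^{d−e}` with `1 ≤ e ≤ d`,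
the maximal operator `𝕂_*^α f(x) = sup_{0<s<1} ∫ 𝕂_s^α(x,y) f(y) dν_α(y)` is of weak
type `(1,1)` with respect to `ν_α`. -/
theorem stmt9 (d e : ℕ) (hd : 1 ≤ d) (he : 1 ≤ e) (hed : e ≤ d) (α : Fin d → ℝ)
    (hα : ∀ i : Fin d, ((i : ℕ) < e → α i ≤ -1) ∧ (e ≤ (i : ℕ) → -1 < α i)) :
    ∃ C : ℝ, 0 < C ∧ ∀ f : (Fin d → ℝ) → ℝ, (∀ x, 0 ≤ f x) →
      Integrable f (nu d α) → ∀ lam : ℝ, 0 < lam →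
      nu d α {x | ENNReal.ofReal lam <
          ⨆ s ∈ Set.Ioo (0 : ℝ) 1,
            ∫⁻ y, ENNReal.ofReal (KK d e hed α s x y * f y) ∂(nu d α)} ≤
        ENNReal.ofReal (C / lam * ∫ x, f x ∂(nu d α)) := by
  have hnu : nu d α = Measure.pi (fun i => nu1 (2 * α i + 1)) := nu_eq d α
  have hcB : ∀ i, CoordB (2 * α i + 1) (kk e α i) := by
    intro i
    by_cases hi : (i : ℕ) < e
    · have h := coordB_bad (-α i) (by linarith [(hα i).1 hi])
      have e1 : kk e α i = kb (-α i) := by funext s x y; simp [kk, hi]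
      rw [e1, show 2 * α i + 1 = 1 - 2 * -α i by ring]
      exact h
    · have h := coordB_good (2 * α i + 1) (by linarith [(hα i).2 (not_lt.1 hi)])
      have e1 : kk e α i = kg (2 * α i + 1) := by funext s x y; simp [kk, hi]
      rw [e1]
      exact h
  have hub : ∀ i, ∃ b Cu : ℝ, 0 ≤ b ∧ b < 1 ∧ 1 ≤ Cu ∧ ∀ s x y, 0 < s → s < 1 → 0 < x → 0 < y →
      kk e α i s x y * w1 (2 * α i + 1) x ≤ Cu * UU b s x y := by
    intro i
    by_cases hi : (i : ℕ) < e
    · obtain ⟨C, hC, h⟩ := ub_bad (-α i) (by linarith [(hα i).1 hi])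
      refine ⟨0, C, le_rfl, one_pos, hC, ?_⟩
      have e1 : kk e α i = kb (-α i) := by funext s x y; simp [kk, hi]
      rw [e1, show 2 * α i + 1 = 1 - 2 * -α i by ring]
      exact h
    · refine ⟨max 0 (-(2 * α i + 1)), 1, le_max_left _ _, max_lt one_pos (by linarith [(hα i).2 (not_lt.1 hi)]), le_rfl, ?_⟩
      have e1 : kk e α i = kg (2 * α i + 1) := by funext s x y; simp [kk, hi]
      rw [e1]
      intro s x y hs hs1 hx hy
      rw [one_mul]
      exact ub_good _ hs hx
  choose b Cu hb hb1 hCu hk using hub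
  obtain ⟨CB, hCB, hB⟩ := regB' (fun i => 2 * α i + 1) (kk e α) hcB
  have hAj : ∀ j : Fin d, ∃ C : ENNReal, C ≠ ⊤ ∧ ∀ (μ : Measure (Fin d → ℝ)) [IsFiniteMeasure μ],
      (∀ᵐ y ∂μ, ∀ i, 0 < y i) → ∀ lam : ENNReal,
      lam * Measure.pi (fun i => nu1 (2 * α i + 1)) {x | (∀ i, 0 < x i) ∧ (∀ i, x i ≤ x j) ∧
        ∃ s, 0 < s ∧ s < 1 ∧ 1 < s * x j ^ 2 ∧
        lam < ∫⁻ y, ∏ i, ENNReal.ofReal (kk e α i s (x i) (y i)) ∂μ} ≤ C * μ Set.univ := by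
    obtain ⟨n, rfl⟩ : ∃ n, d = n + 1 := ⟨d - 1, by omega⟩
    intro j
    exact regA _ _ b Cu hb hb1 hCu (fun i s x y hs hs1 hx hy => kk_nonneg e α i hs hs1 hx hy) hk j
  choose CA hCA hA using hAj
  set Ct : ENNReal := CB + ∑ j, CA j with hCt
  have hCtT : Ct ≠ ⊤ := ENNReal.add_ne_top.2 ⟨hCB, ENNReal.sum_ne_top.2 fun j _ => hCA j⟩
  refine ⟨Ct.toReal + 1, by positivity, ?_⟩
  intro f hf hfi lam hlam
  have hpos : MeasurableSet {x : Fin d → ℝ | ∀ i, 0 < x i} := by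
    rw [Set.ofPred_forall]
    exact MeasurableSet.iInter fun i => measurableSet_lt measurable_const (measurable_pi_apply i)
  have hae : ∀ᵐ y ∂(nu d α), ∀ i, 0 < y i := ae_restrict_mem hpos
  have hfm : AEMeasurable (fun y => ENNReal.ofReal (f y)) (nu d α) := hfi.1.aemeasurable.ennreal_ofReal
  set μ := (nu d α).withDensity (fun y => ENNReal.ofReal (f y)) with hμ
  have hμu : μ Set.univ = ENNReal.ofReal (∫ x, f x ∂(nu d α)) := by
    rw [hμ, withDensity_apply _ MeasurableSet.univ, Measure.restrict_univ,
      ofReal_integral_eq_lintegral_ofReal hfi (Filter.Eventually.of_forall hf)]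
  haveI : IsFiniteMeasure μ := ⟨by rw [hμu]; exact ENNReal.ofReal_lt_top⟩
  have hμae : ∀ᵐ y ∂μ, ∀ i, 0 < y i := (withDensity_absolutelyContinuous _ _).ae_le hae
  have hint : ∀ s x, 0 < s → s < 1 → (∀ i, 0 < x i) →
      ∫⁻ y, ENNReal.ofReal (KK d e hed α s x y * f y) ∂(nu d α) =
      ∫⁻ y, ∏ i, ENNReal.ofReal (kk e α i s (x i) (y i)) ∂μ := by
    intro s x hs hs1 hx
    have hgm : Measurable fun y : Fin d → ℝ => ∏ i, ENNReal.ofReal (kk e α i s (x i) (y i)) :=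
      Finset.measurable_prod _ fun i _ => ((kk_meas e α i s (x i)).comp (measurable_pi_apply i)).ennreal_ofReal
    rw [hμ, lintegral_withDensity_eq_lintegral_mul₀ hfm hgm.aemeasurable]
    refine lintegral_congr_ae ?_
    filter_upwards [hae] with y hy
    have hn : ∀ i ∈ Finset.univ, 0 ≤ kk e α i s (x i) (y i) := fun i _ => kk_nonneg e α i hs hs1 (hx i) (hy i)
    rw [KK_eq d e hed α hs hs1, ENNReal.ofReal_mul (Finset.prod_nonneg hn),
      ENNReal.ofReal_prod_of_nonneg hn, mul_comm]
    rfl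
  set L := ENNReal.ofReal lam with hL
  have hL0 : L ≠ 0 := by simpa [hL] using hlam
  set EB := {x : Fin d → ℝ | (∀ i, 0 < x i) ∧ ∃ s, 0 < s ∧ s < 1 ∧ (∀ i, s * x i ^ 2 ≤ 1) ∧
    L < ∫⁻ y, ∏ i, ENNReal.ofReal (kk e α i s (x i) (y i)) ∂μ} with hEB
  set EA := fun j : Fin d => {x : Fin d → ℝ | (∀ i, 0 < x i) ∧ (∀ i, x i ≤ x j) ∧
        ∃ s, 0 < s ∧ s < 1 ∧ 1 < s * x j ^ 2 ∧
        L < ∫⁻ y, ∏ i, ENNReal.ofReal (kk e α i s (x i) (y i)) ∂μ} with hEA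
  have hsub : ∀ᵐ x ∂(nu d α), x ∈ {x | L < ⨆ s ∈ Set.Ioo (0 : ℝ) 1,
      ∫⁻ y, ENNReal.ofReal (KK d e hed α s x y * f y) ∂(nu d α)} → x ∈ EB ∪ ⋃ j, EA j := by
    filter_upwards [hae] with x hx hxm
    have hxm' : L < ⨆ s ∈ Set.Ioo (0 : ℝ) 1,
      ∫⁻ y, ENNReal.ofReal (KK d e hed α s x y * f y) ∂(nu d α) := hxm
    simp only [lt_iSup_iff] at hxm'
    obtain ⟨s, ⟨hs, hs1⟩, hl⟩ := hxm'
    rw [hint s x hs hs1 hx] at hl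
    by_cases hc : ∀ i, s * x i ^ 2 ≤ 1
    · exact Or.inl ⟨hx, s, hs, hs1, hc, hl⟩
    · push Not at hc
      obtain ⟨i, hi⟩ := hc
      haveI : Nonempty (Fin d) := ⟨i⟩
      obtain ⟨j, hj⟩ := Finite.exists_max x
      refine Or.inr (Set.mem_iUnion.2 ⟨j, hx, hj, s, hs, hs1, hi.trans_le ?_, hl⟩)
      have := hx i
      have := hj i
      gcongr
  have hmain : L * nu d α {x | L < ⨆ s ∈ Set.Ioo (0 : ℝ) 1,
      ∫⁻ y, ENNReal.ofReal (KK d e hed α s x y * f y) ∂(nu d α)} ≤ Ct * μ Set.univ := by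
    calc _ ≤ L * (nu d α EB + ∑ j, nu d α (EA j)) := by
          refine mul_le_mul' le_rfl ((measure_mono_ae hsub).trans ((measure_union_le _ _).trans ?_))
          exact add_le_add le_rfl (measure_iUnion_fintype_le _ _)
      _ = L * nu d α EB + ∑ j, L * nu d α (EA j) := by rw [mul_add, Finset.mul_sum]
      _ ≤ CB * μ Set.univ + ∑ j, CA j * μ Set.univ := by
          rw [hnu] at *
          exact add_le_add (hB μ hμae L) (Finset.sum_le_sum fun j _ => hA j μ hμae L)
      _ = _ := by rw [hCt, add_mul, Finset.sum_mul]
  have hI : 0 ≤ ∫ x, f x ∂(nu d α) := integral_nonneg hf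
  rw [show (Ct.toReal + 1) / lam * ∫ x, f x ∂(nu d α) = ((Ct.toReal + 1) * ∫ x, f x ∂(nu d α)) / lam by ring,
    ENNReal.ofReal_div_of_pos hlam, ENNReal.le_div_iff_mul_le (Or.inl hL0) (Or.inl ENNReal.ofReal_ne_top),
    mul_comm, ENNReal.ofReal_mul (by positivity), ← hμu]
  refine hmain.trans (mul_le_mul' ?_ le_rfl)
  rw [← ENNReal.ofReal_toReal hCtT, ENNReal.toReal_ofReal ENNReal.toReal_nonneg]
  exact ENNReal.ofReal_le_ofReal (by linarith)
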